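/- arXiv:2401.15361 — 3 statements merged into one kernel-verified Lean document; each statement's English description precedes it below -/
import Mathlib

section
/- Let P be a d-polytope and 0 ≤ k ≤ d−1. Then f_k(P) = ρ(d,d−k−1) · f_{d−1}(P) holds if and only if k = d−1, or k = d−2 and P is simplicial. -/
noncomputable section

/-- Euclidean space `ℝ^n`. -/
abbrev Euc (n : ℕ) : Type := EuclideanSpace ℝ (Fin n)

/-- A polytope is the convex hull of finitely many points. -/
def IsPolytope {E : Type*} [NormedAddCommGroup E] [InnerProductSpace ℝ E] (P : Set E) : Prop :=
  ∃ V : Finset E, P = convexHull ℝ (V : Set E)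

/-- `G` is a face of `P`: `P` itself, the empty set, or the intersection of `P` with a
supporting hyperplane. -/
def IsFace {E : Type*} [NormedAddCommGroup E] [InnerProductSpace ℝ E] (P G : Set E) : Prop :=
  G = P ∨ G = ∅ ∨ ∃ f : E →L[ℝ] ℝ, f ≠ 0 ∧ ∃ c : ℝ,
    (∀ x ∈ P, f x ≤ c) ∧ G = {x ∈ P | f x = c}

/-- The (affine) dimension of a nonempty set. -/
noncomputable def dimSet {E : Type*} [NormedAddCommGroup E] [InnerProductSpace ℝ E]
    (s : Set E) : ℕ :=
  Module.finrank ℝ (affineSpan ℝ s).direction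

/-- `G` is a `k`-dimensional face of `P`. -/
def IsKFace {E : Type*} [NormedAddCommGroup E] [InnerProductSpace ℝ E]
    (P : Set E) (k : ℕ) (G : Set E) : Prop :=
  IsFace P G ∧ G.Nonempty ∧ dimSet G = k

/-- `fVec P k` is the number of `k`-dimensional faces of `P`. -/
noncomputable def fVec {E : Type*} [NormedAddCommGroup E] [InnerProductSpace ℝ E]
    (P : Set E) (k : ℕ) : ℕ :=
  {G | IsKFace P k G}.ncard

/-- `ρ(d,k) = (1/2)(binom(⌈d/2⌉,k) + binom(⌊d/2⌋,k))`. -/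
def rho (d k : ℕ) : ℚ :=
  (((d + 1) / 2).choose k + (d / 2).choose k) / 2

/-- A `d`-polytope is simplicial if each of its facets is a simplex, i.e. has exactly
`d` vertices. -/
def IsSimplicialPolytope {E : Type*} [NormedAddCommGroup E] [InnerProductSpace ℝ E]
    (P : Set E) (d : ℕ) : Prop :=
  ∀ F : Set E, IsKFace P (d - 1) F → fVec F 0 = d

namespace VFace
variable {α L : Type*} [AddCommGroup L] [Module ℝ L]

/-- The members of the system `e` of real functions that vanish on `T`. -/
def vanishing (e : L →ₗ[ℝ] α → ℝ) (T : Finset α) : Submodule ℝ L where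
  carrier := {g | ∀ t ∈ T, e g t = 0}
  add_mem' := by
    intro a b ha hb t ht
    simp [ha t ht, hb t ht]
  zero_mem' := by intro t _; simp
  smul_mem' := by
    intro c x hx t ht
    simp [hx t ht]

/-- The dimension of the space of functions vanishing on `T`. -/
def corank (e : L →ₗ[ℝ] α → ℝ) (T : Finset α) : ℕ := Module.finrank ℝ (vanishing e T)

/-- `T` is the zero set in `V` of a function that is nonnegative on `V`. -/
def IsVFace (e : L →ₗ[ℝ] α → ℝ) (V T : Finset α) : Prop :=
  T ⊆ V ∧ ∃ g : L, (∀ v ∈ T, e g v = 0) ∧ ∀ v ∈ V, v ∉ T → 0 < e g v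

variable {e : L →ₗ[ℝ] α → ℝ} {V F T A B K : Finset α}

@[simp] lemma mem_vanishing {g : L} : g ∈ vanishing e T ↔ ∀ t ∈ T, e g t = 0 := Iff.rfl

lemma vanishing_anti (h : A ⊆ B) : vanishing e B ≤ vanishing e A :=
  fun _ hg t ht => hg t (h ht)

lemma corank_anti [FiniteDimensional ℝ L] (h : A ⊆ B) : corank e B ≤ corank e A :=
  Submodule.finrank_mono (vanishing_anti h)

lemma IsVFace.refl (e : L →ₗ[ℝ] α → ℝ) (V : Finset α) : IsVFace e V V :=
  ⟨subset_rfl, 0, by simp, fun v hv hv' => absurd hv hv'⟩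

lemma IsVFace.of_subset (h : IsVFace e V T) (hF : F ⊆ V) (hT : T ⊆ F) : IsVFace e F T := by
  obtain ⟨-, g, h0, hpos⟩ := h
  exact ⟨hT, g, h0, fun v hv hv' => hpos v (hF hv) hv'⟩

lemma IsVFace.nonneg {g : L} (h0 : ∀ v ∈ T, e g v = 0) (hpos : ∀ v ∈ V, v ∉ T → 0 < e g v)
    {v : α} (hv : v ∈ V) : 0 ≤ e g v := by
  by_cases h : v ∈ T
  · exact (h0 v h).ge
  · exact (hpos v hv h).le

lemma isVFace_filter [DecidableEq α] {g : L} (hg : ∀ v ∈ V, 0 ≤ e g v) :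
    IsVFace e V {v ∈ V | e g v = 0} := by
  refine ⟨Finset.filter_subset _ _, g, fun v hv => (Finset.mem_filter.1 hv).2, ?_⟩
  intro v hv hv'
  refine lt_of_le_of_ne (hg v hv) fun h => hv' ?_
  simp [hv, h.symm]

lemma IsVFace.trans (hF : IsVFace e V F) (hT : IsVFace e F T) : IsVFace e V T := by
  obtain ⟨hFV, g, g0, gpos⟩ := hF
  obtain ⟨hTF, h, h0, hpos⟩ := hT
  obtain ⟨M, hM⟩ : ∃ M : ℝ, ∀ v ∈ V, v ∉ F → 0 < e h v + M * e g v := by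
    have : ∀ᶠ M : ℝ in Filter.atTop, ∀ v ∈ V, v ∉ F → 0 < e h v + M * e g v := by
      rw [Filter.eventually_all_finset]
      intro v hv
      rw [Filter.eventually_imp_distrib_left]
      intro hvF
      have := (Filter.tendsto_atTop_add_const_left Filter.atTop (e h v)
        (Filter.tendsto_id.atTop_mul_const (gpos v hv hvF)))
      exact this.eventually_gt_atTop 0
    exact this.exists
  refine ⟨hTF.trans hFV, h + M • g, ?_, ?_⟩
  · intro v hv
    simp [h0 v hv, g0 v (hTF hv)]
  · intro v hv hvT
    by_cases hvF : v ∈ F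
    · simpa [g0 v hvF] using hpos v hvF hvT
    · simpa using hM v hv hvF

lemma IsVFace.inter [DecidableEq α] (hA : IsVFace e V A) (hB : IsVFace e V B) :
    IsVFace e V (A ∩ B) := by
  obtain ⟨hAV, g, g0, gpos⟩ := hA
  obtain ⟨hBV, h, h0, hpos⟩ := hB
  refine ⟨Finset.inter_subset_left.trans hAV, g + h, ?_, ?_⟩
  · intro v hv
    rw [Finset.mem_inter] at hv
    simp [g0 v hv.1, h0 v hv.2]
  · intro v hv hv'
    have h1 := IsVFace.nonneg g0 gpos hv
    have h2 := IsVFace.nonneg h0 hpos hv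
    by_cases hvA : v ∈ A
    · have : v ∉ B := fun h => hv' (Finset.mem_inter.2 ⟨hvA, h⟩)
      have := hpos v hv this
      simp only [map_add, Pi.add_apply]
      linarith
    · have := gpos v hv hvA
      simp only [map_add, Pi.add_apply]
      linarith

lemma IsVFace.corank_lt [FiniteDimensional ℝ L] (hA : IsVFace e V A) (h : A ≠ V) :
    corank e V < corank e A := by
  obtain ⟨hAV, g, g0, gpos⟩ := hA
  refine Submodule.finrank_lt_finrank_of_lt (lt_of_le_of_ne (vanishing_anti hAV) fun heq => ?_)
  obtain ⟨v, hv, hvA⟩ := Finset.exists_of_ssubset (hAV.ssubset_of_ne h)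
  have : g ∈ vanishing e V := heq ▸ (show g ∈ vanishing e A from g0)
  exact (gpos v hv hvA).ne' (this v hv)

lemma IsVFace.eq_of_subset [FiniteDimensional ℝ L] (hA : IsVFace e V A) (hB : IsVFace e V B)
    (h : A ⊆ B) (hc : corank e A ≤ corank e B) : A = B := by
  by_contra hne
  exact (hc.trans_lt ((hA.of_subset hB.1 h).corank_lt hne)).false

lemma exists_first_zero {g h : L} (hg : ∀ v ∈ V, 0 ≤ e g v)
    (hgh : ∀ v ∈ V, e g v = 0 → 0 ≤ e h v) (hneg : ∃ v ∈ V, e h v < 0) :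
    ∃ t : ℝ, 0 < t ∧ (∀ v ∈ V, 0 ≤ e (g + t • h) v) ∧ ∃ v ∈ V, e (g + t • h) v = 0 ∧ e h v < 0 := by
  classical
  obtain ⟨w, hw, hmin⟩ := Finset.exists_min_image {v ∈ V | e h v < 0}
    (fun v => e g v / (-e h v)) (by obtain ⟨v, hv, h'⟩ := hneg; exact ⟨v, by simp [hv, h']⟩)
  simp only [Finset.mem_filter, and_imp] at hw hmin
  have hpos : 0 < e g w :=
    lt_of_le_of_ne (hg w hw.1) fun h0 => (hgh w hw.1 h0.symm).not_gt hw.2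
  refine ⟨e g w / (-e h w), div_pos hpos (by linarith [hw.2]), ?_, w, hw.1, ?_, hw.2⟩
  · intro v hv
    simp only [map_add, map_smul, Pi.add_apply, Pi.smul_apply, smul_eq_mul]
    by_cases hv' : e h v < 0
    · have := hmin v hv hv'
      rw [le_div_iff₀ (by linarith)] at this
      linarith
    · have : 0 ≤ e g w / (-e h w) * e h v :=
        mul_nonneg (div_nonneg hpos.le (by linarith [hw.2])) (not_lt.1 hv')
      linarith [hg v hv]
  · simp only [map_add, map_smul, Pi.add_apply, Pi.smul_apply, smul_eq_mul]
    have : e h w ≠ 0 := hw.2.ne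
    field_simp
    ring

lemma IsVFace.exists_coatom [FiniteDimensional ℝ L] {v₀ : α} (hA : IsVFace e V A) (hv : v₀ ∈ V)
    (hvA : v₀ ∉ A) :
    ∃ K, IsVFace e V K ∧ A ⊆ K ∧ v₀ ∉ K ∧ corank e K = corank e V + 1 := by
  classical
  induction hn : corank e A using Nat.strong_induction_on generalizing A with
  | _ n ih =>
  have hlt := hA.corank_lt (fun h => hvA (h ▸ hv))
  rcases eq_or_lt_of_le (Nat.succ_le_of_lt hlt) with h1 | h1
  · exact ⟨A, hA, subset_rfl, hvA, h1.symm⟩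
  obtain ⟨hAV, g, g0, gpos⟩ := id hA
  obtain ⟨h, hhA, hhv, hhV⟩ : ∃ h ∈ vanishing e A, e h v₀ = 0 ∧ h ∉ vanishing e V := by
    by_contra! hcon
    let φ : vanishing e A →ₗ[ℝ] ℝ := (LinearMap.proj v₀ ∘ₗ e) ∘ₗ (vanishing e A).subtype
    have hk : Module.finrank ℝ (LinearMap.ker φ) ≤ corank e V := by
      have : (LinearMap.ker φ).map (vanishing e A).subtype ≤ vanishing e V := by
        rintro _ ⟨x, hx, rfl⟩
        exact hcon x x.2 hx
      calc _ = Module.finrank ℝ ((LinearMap.ker φ).map (vanishing e A).subtype) :=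
            (LinearEquiv.finrank_eq (Submodule.equivMapOfInjective _
              (Submodule.injective_subtype _) _))
        _ ≤ _ := Submodule.finrank_mono this
    have hr : Module.finrank ℝ (LinearMap.range φ) ≤ 1 := by
      simpa using Submodule.finrank_le (LinearMap.range φ)
    have := LinearMap.finrank_range_add_finrank_ker φ
    unfold corank at *
    omega
  obtain ⟨h, hhA, hhv, hneg⟩ : ∃ h ∈ vanishing e A, e h v₀ = 0 ∧ ∃ v ∈ V, e h v < 0 := by
    simp only [mem_vanishing, not_forall] at hhV
    obtain ⟨v, hv, hne⟩ := hhV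
    rcases lt_or_gt_of_ne hne with h' | h'
    · exact ⟨h, hhA, hhv, v, hv, h'⟩
    · exact ⟨-h, neg_mem hhA, by simp [hhv], v, hv, by simpa using h'⟩
  obtain ⟨t, -, hnn, w, hw, hw0, hwneg⟩ := exists_first_zero
    (fun v hv => IsVFace.nonneg g0 gpos hv)
    (fun v hv h0 => (hhA v (by by_contra hvA'; exact (gpos v hv hvA').ne' h0)).ge) hneg
  have hF := isVFace_filter hnn
  set K := {v ∈ V | e (g + t • h) v = 0} with hK
  have hAK : A ⊆ K := by
    intro v hv
    simp [hK, hAV hv, g0 v hv, hhA v hv]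
  have hv₀K : v₀ ∉ K := by
    have := gpos v₀ hv hvA
    simp [hK, hhv, this.ne']
  have hne : A ≠ K := by
    rintro h'
    have : w ∈ A := h' ▸ (by rw [hK]; exact Finset.mem_filter.2 ⟨hw, hw0⟩)
    exact hwneg.ne (hhA w this)
  have hlt := (hA.of_subset hF.1 hAK).corank_lt hne
  obtain ⟨K', h1, h2, h3, h4⟩ := ih _ (hn ▸ hlt) hF hv₀K rfl
  exact ⟨K', h1, hAK.trans h2, h3, h4⟩

lemma IsVFace.exists_atom [FiniteDimensional ℝ L] {W : Finset α} (hW : IsVFace e V W)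
    (hK : IsVFace e V K) (hWK : W ⊆ K) (hKV : K ≠ V) :
    ∃ W', IsVFace e V W' ∧ W ⊆ W' ∧ ¬ W' ⊆ K ∧ corank e W' + 1 = corank e W := by
  classical
  induction hn : V.card using Nat.strong_induction_on generalizing V K with
  | _ n ih =>
  have hVK : ¬ V ⊆ K := fun h => hKV (hK.1.antisymm h)
  obtain ⟨v, hv, hvK⟩ := Finset.not_subset.1 hVK
  have hlt := hW.corank_lt (fun h => hvK (hWK (h ▸ hv)))
  rcases eq_or_lt_of_le (Nat.succ_le_of_lt hlt) with h1 | h1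
  · exact ⟨V, .refl e V, hW.1, hVK, h1⟩
  obtain ⟨V', hV', hWV', hV'K, hne⟩ : ∃ V', IsVFace e V V' ∧ W ⊆ V' ∧ ¬ V' ⊆ K ∧ V' ≠ V := by
    obtain ⟨C, hC, hWC, hvC, hcC⟩ := hW.exists_coatom hv (fun h => hvK (hWK h))
    by_cases hCK : C ⊆ K
    · obtain ⟨hWV, g, g0, gpos⟩ := id hW
      obtain ⟨-, k, k0, kpos⟩ := id hK
      have : ¬ K ⊆ W := by
        intro h
        have h2 : corank e W ≤ corank e C := corank_anti (hCK.trans h)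
        omega
      obtain ⟨u, huK, huW⟩ := Finset.not_subset.1 this
      obtain ⟨t, -, hnn, w, hw, hw0, hwneg⟩ := exists_first_zero (g := g) (h := -k)
        (fun v hv => IsVFace.nonneg g0 gpos hv)
        (fun v hv h0 => by
          have : v ∈ W := by by_contra h'; exact (gpos v hv h').ne' h0
          simp [k0 v (hWK this)])
        ⟨v, hv, by simpa using kpos v hv hvK⟩
      refine ⟨_, isVFace_filter hnn, ?_, ?_, ?_⟩
      · intro x hx
        simp [hWV hx, g0 x hx, k0 x (hWK hx)]
      · intro h
        have := h (Finset.mem_filter.2 ⟨hw, hw0⟩)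
        simp [k0 w this] at hwneg
      · intro h
        have : u ∈ V := hK.1 huK
        rw [← h, Finset.mem_filter] at this
        have h2 := gpos u (hK.1 huK) huW
        simp [k0 u huK, h2.ne'] at this
    · exact ⟨C, hC, hWC, hCK, fun h => hvC (h ▸ hv)⟩
  obtain ⟨W', h1, h2, h3, h4⟩ := ih V'.card
    (hn ▸ Finset.card_lt_card (hV'.1.ssubset_of_ne hne)) (V := V') (K := K ∩ V')
    (hW.of_subset hV'.1 hWV') ((hK.inter hV').of_subset hV'.1 Finset.inter_subset_right)
    (Finset.subset_inter hWK hWV') (fun h => hV'K (by rw [← h]; exact Finset.inter_subset_left)) rfl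
  exact ⟨W', hV'.trans h1, h2, fun h => h3 (Finset.subset_inter h h1.1), h4⟩

open Classical in
/-- The faces of `V` of relative corank `c` that contain `W`. -/
def facesAbove (e : L →ₗ[ℝ] α → ℝ) (V W : Finset α) (c : ℕ) : Finset (Finset α) :=
  {T ∈ V.powerset | IsVFace e V T ∧ W ⊆ T ∧ corank e T = corank e V + c}

lemma mem_facesAbove {W : Finset α} {c : ℕ} :
    T ∈ facesAbove e V W c ↔ IsVFace e V T ∧ W ⊆ T ∧ corank e T = corank e V + c := by
  simp only [facesAbove, Finset.mem_filter, Finset.mem_powerset, and_iff_right_iff_imp]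
  exact fun h => h.1.1

lemma IsVFace.choose_le_card_facesAbove [FiniteDimensional ℝ L] {W : Finset α}
    (hW : IsVFace e V W) (c : ℕ) :
    (corank e W - corank e V).choose c ≤ (facesAbove e V W c).card := by
  classical
  induction ha : corank e W - corank e V generalizing V W c with
  | zero =>
    rcases c with _ | c
    · rw [Nat.choose_zero_right, Nat.succ_le_iff, Finset.card_pos]
      exact ⟨V, mem_facesAbove.2 ⟨.refl e V, hW.1, rfl⟩⟩
    · simp
  | succ a ih =>
    rcases c with _ | c
    · rw [Nat.choose_zero_right, Nat.succ_le_iff, Finset.card_pos]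
      exact ⟨V, mem_facesAbove.2 ⟨.refl e V, hW.1, rfl⟩⟩
    have hne : ¬ V ⊆ W := by
      intro h
      have := corank_anti (e := e) h
      omega
    obtain ⟨v, hv, hvW⟩ := Finset.not_subset.1 hne
    obtain ⟨K, hK, hWK, hvK, hcK⟩ := hW.exists_coatom hv hvW
    obtain ⟨W', hW', hWW', hW'K, hcW'⟩ := hW.exists_atom hK hWK (fun h => hvK (h ▸ hv))
    have h1 := ih (hW.of_subset hK.1 hWK) c (by omega)
    have h2 := ih hW' (c + 1) (by omega)
    have hdisj : Disjoint (facesAbove e K W c) (facesAbove e V W' (c + 1)) := by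
      rw [Finset.disjoint_left]
      intro T hT hT'
      exact hW'K ((mem_facesAbove.1 hT').2.1.trans (mem_facesAbove.1 hT).1.1)
    rw [Nat.choose_succ_succ]
    calc _ ≤ _ := add_le_add h1 h2
      _ = _ := (Finset.card_union_of_disjoint hdisj).symm
      _ ≤ _ := Finset.card_le_card ?_
    intro T hT
    rw [Finset.mem_union, mem_facesAbove, mem_facesAbove] at hT
    rw [mem_facesAbove]
    rcases hT with ⟨h1, h2, h3⟩ | ⟨h1, h2, h3⟩
    · exact ⟨hK.trans h1, h2, by omega⟩
    · exact ⟨h1, hWW'.trans h2, h3⟩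

lemma exists_pos_forall_notMem {c₀ : L} (hc : ∀ v ∈ V, 0 < e c₀ v) {S : Set (Submodule ℝ L)}
    (hS : S.Finite) (htop : ⊤ ∉ S) :
    ∃ c : L, (∀ v ∈ V, 0 < e c v) ∧ ∀ p ∈ S, c ∉ p := by
  obtain ⟨c₁, hc₁⟩ : ∃ c₁ : L, ∀ p ∈ S, c₁ ∉ p := by
    have := Subspace.biUnion_ne_univ_of_top_notMem (s := hS.toFinset) (by simpa using htop)
    rw [Set.ne_univ_iff_exists_notMem] at this
    simpa using this
  have h1 : ∀ᶠ ε : ℝ in nhdsWithin 0 (Set.Ioi 0), ∀ v ∈ V, 0 < e (c₀ + ε • c₁) v := by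
    rw [Filter.eventually_all_finset]
    intro v hv
    have : Filter.Tendsto (fun ε : ℝ => e (c₀ + ε • c₁) v) (nhds 0) (nhds (e c₀ v)) := by
      have : Continuous (fun ε : ℝ => e c₀ v + ε * e c₁ v) := by fun_prop
      simpa using this.tendsto 0
    exact (this.eventually (lt_mem_nhds (hc v hv))).filter_mono nhdsWithin_le_nhds
  have h2 : ∀ᶠ ε : ℝ in nhdsWithin 0 (Set.Ioi 0), ∀ p ∈ S, c₀ + ε • c₁ ∉ p := by
    rw [Filter.eventually_all_finite hS]
    intro p hp
    by_cases hex : ∃ ε : ℝ, c₀ + ε • c₁ ∈ p ∧ 0 < ε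
    · obtain ⟨ε₀, hε₀, hpos⟩ := hex
      filter_upwards [(gt_mem_nhds hpos).filter_mono nhdsWithin_le_nhds] with ε hε hmem
      refine hc₁ p hp ?_
      have := p.sub_mem hε₀ hmem
      rw [add_sub_add_left_eq_sub, ← sub_smul] at this
      exact (p.smul_mem_iff (sub_ne_zero.2 hε.ne')).1 this
    · filter_upwards [self_mem_nhdsWithin] with ε hε hmem
      exact hex ⟨ε, hmem, hε⟩
  obtain ⟨ε, h3, h4⟩ := (h1.and h2).exists
  exact ⟨_, h3, h4⟩

lemma exists_isMax_box [FiniteDimensional ℝ L] {c : L} (hc : ∀ v ∈ V, 0 < e c v)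
    {z : Module.Dual ℝ L} (hz : ∀ g ∈ vanishing e V, z g = 0) :
    ∃ h : L, (∀ v ∈ V, 0 ≤ e h v ∧ e h v ≤ e c v) ∧
      ∀ g : L, (∀ v ∈ V, 0 ≤ e g v ∧ e g v ≤ e c v) → z g ≤ z h := by
  let r : L →ₗ[ℝ] (V → ℝ) := LinearMap.pi fun v => LinearMap.proj (v : α) ∘ₗ e
  have hr : ∀ g v, r g v = e g v := fun g v => rfl
  have : z ∈ LinearMap.range r.dualMap := by
    rw [LinearMap.range_dualMap_eq_dualAnnihilator_ker, Submodule.mem_dualAnnihilator]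
    intro g hg
    refine hz g fun v hv => ?_
    simpa [hr] using congrFun (LinearMap.mem_ker.1 hg) ⟨v, hv⟩
  obtain ⟨ζ, rfl⟩ := this
  have hcomp : IsCompact ((LinearMap.range r : Set (V → ℝ)) ∩ Set.Icc 0 (r c)) :=
    isCompact_Icc.inter_left (Submodule.closed_of_finiteDimensional _)
  obtain ⟨x, ⟨⟨h, rfl⟩, hx⟩, hmax⟩ := hcomp.exists_isMaxOn
    ⟨0, zero_mem _, le_rfl, fun v => (hc v v.2).le⟩
    (LinearMap.continuous_of_finiteDimensional ζ).continuousOn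
  refine ⟨h, fun v hv => ⟨hx.1 ⟨v, hv⟩, hx.2 ⟨v, hv⟩⟩, fun g hg => ?_⟩
  exact hmax ⟨⟨g, rfl⟩, fun v => (hg v v.2).1, fun v => (hg v v.2).2⟩

lemma exists_pos_mul_le {f g : α → ℝ} (hfg : ∀ v ∈ V, g v ≠ 0 → 0 < f v)
    (hf : ∀ v ∈ V, 0 ≤ f v) : ∃ ε : ℝ, 0 < ε ∧ ∀ v ∈ V, ε * g v ≤ f v := by
  have : ∀ᶠ ε : ℝ in nhdsWithin 0 (Set.Ioi 0), ∀ v ∈ V, ε * g v ≤ f v := by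
    rw [Filter.eventually_all_finset]
    intro v hv
    by_cases h : g v = 0
    · simp [h, hf v hv]
    · have h1 : Filter.Tendsto (fun ε : ℝ => ε * g v) (nhds 0) (nhds 0) := by
        have : Continuous (fun ε : ℝ => ε * g v) := by fun_prop
        simpa using this.tendsto 0
      exact ((h1.eventually (gt_mem_nhds (hfg v hv h))).filter_mono
        nhdsWithin_le_nhds).mono fun _ h => h.le
  obtain ⟨ε, h1, h2⟩ := (this.and self_mem_nhdsWithin).exists
  exact ⟨ε, h2, h1⟩

/-- A functional on the functions on `V` splits `V` into a face on which it looks nonnegative and a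
complementary face on which it looks nonpositive. -/
lemma exists_complementary_faces [FiniteDimensional ℝ L] {c₀ : L} (hc₀ : ∀ v ∈ V, 0 < e c₀ v)
    {z : Module.Dual ℝ L} (hz : ∀ g ∈ vanishing e V, z g = 0) :
    ∃ A B, IsVFace e V A ∧ IsVFace e V B ∧
      Module.finrank ℝ L + corank e V ≤ corank e A + corank e B ∧
      (∀ g : L, (∀ v ∈ V, 0 ≤ e g v) → (∀ v ∈ A, e g v = 0) → z g ≤ 0) ∧
      ∀ g : L, (∀ v ∈ V, 0 ≤ e g v) → (∀ v ∈ B, e g v = 0) → 0 ≤ z g := by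
  classical
  let S : Set (Submodule ℝ L) :=
    ((fun q : Finset α × Finset α => vanishing e q.1 ⊔ vanishing e q.2) ''
      (V.powerset ×ˢ V.powerset : Finset (Finset α × Finset α))) \ {⊤}
  obtain ⟨c, hc, hcS⟩ := exists_pos_forall_notMem hc₀ (S := S)
    (((Finset.finite_toSet _).image _).sdiff) (by simp [S])
  obtain ⟨h, hbox, hmax⟩ := exists_isMax_box hc hz
  have hA := isVFace_filter (e := e) (V := V) (g := c - h)
    (fun v hv => by simpa using (hbox v hv).2)
  have hB := isVFace_filter (e := e) (V := V) (g := h) (fun v hv => (hbox v hv).1)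
  set A := {v ∈ V | e (c - h) v = 0} with hAdef
  set B := {v ∈ V | e h v = 0} with hBdef
  have htop : vanishing e A ⊔ vanishing e B = ⊤ := by
    by_contra hne
    refine hcS (vanishing e A ⊔ vanishing e B) ⟨⟨(A, B), by simp [hA.1, hB.1], rfl⟩, hne⟩ ?_
    rw [← sub_add_cancel c h]
    exact Submodule.add_mem_sup (fun v hv => (Finset.mem_filter.1 hv).2)
      (fun v hv => (Finset.mem_filter.1 hv).2)
  refine ⟨A, B, hA, hB, ?_, ?_, ?_⟩
  · have h1 := Submodule.finrank_sup_add_finrank_inf_eq (vanishing e A) (vanishing e B)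
    rw [htop, finrank_top] at h1
    have h2 : corank e V ≤ Module.finrank ℝ ↥(vanishing e A ⊓ vanishing e B) :=
      Submodule.finrank_mono (le_inf (vanishing_anti hA.1) (vanishing_anti hB.1))
    unfold corank at *
    omega
  · intro g hg hgA
    obtain ⟨ε, hε, hle⟩ := exists_pos_mul_le (V := V) (f := e (c - h)) (g := e g)
      (fun v hv hne => lt_of_le_of_ne (by simpa using (hbox v hv).2)
        fun h0 => hne (hgA v (Finset.mem_filter.2 ⟨hv, h0.symm⟩)))
      (fun v hv => by simpa using (hbox v hv).2)
    have := hmax (h + ε • g) (fun v hv => by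
      have h1 := hle v hv
      have h2 := mul_nonneg hε.le (hg v hv)
      have h3 := hbox v hv
      simp only [map_sub, map_add, map_smul, Pi.add_apply, Pi.sub_apply, Pi.smul_apply,
        smul_eq_mul] at *
      constructor <;> linarith)
    simp only [map_add, map_smul, smul_eq_mul] at this
    exact nonpos_of_mul_nonpos_right (by linarith) hε
  · intro g hg hgB
    obtain ⟨ε, hε, hle⟩ := exists_pos_mul_le (V := V) (f := e h) (g := e g)
      (fun v hv hne => lt_of_le_of_ne (hbox v hv).1
        fun h0 => hne (hgB v (Finset.mem_filter.2 ⟨hv, h0.symm⟩)))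
      (fun v hv => (hbox v hv).1)
    have := hmax (h - ε • g) (fun v hv => by
      have h1 := hle v hv
      have h2 := mul_nonneg hε.le (hg v hv)
      have h3 := hbox v hv
      simp only [map_sub, map_smul, Pi.sub_apply, Pi.smul_apply, smul_eq_mul] at *
      constructor <;> linarith)
    simp only [map_sub, map_smul, smul_eq_mul] at this
    exact nonneg_of_mul_nonneg_right (by linarith) hε

lemma exists_facet_normal [FiniteDimensional ℝ L] (hF : IsVFace e V F)
    (hc : corank e F = corank e V + 1) :
    ∃ g : L, (∀ v ∈ F, e g v = 0) ∧ (∀ v ∈ V, v ∉ F → 0 < e g v) ∧ ∑ v ∈ V, e g v = 1 ∧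
      vanishing e F ≤ vanishing e V ⊔ Submodule.span ℝ {g} := by
  obtain ⟨hFV, g, g0, gpos⟩ := hF
  have hne : ¬ V ⊆ F := fun h => by rw [h.antisymm hFV] at hc; omega
  obtain ⟨v, hv, hvF⟩ := Finset.not_subset.1 hne
  have hs : 0 < ∑ v ∈ V, e g v :=
    Finset.sum_pos' (fun v hv => IsVFace.nonneg g0 gpos hv) ⟨v, hv, gpos v hv hvF⟩
  set s := ∑ v ∈ V, e g v
  have hg0 : ∀ v ∈ F, e (s⁻¹ • g) v = 0 := fun v hv => by simp [g0 v hv]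
  refine ⟨s⁻¹ • g, hg0, fun v hv hvF => ?_, ?_, ?_⟩
  · simpa using mul_pos (inv_pos.2 hs) (gpos v hv hvF)
  · simp only [map_smul, Pi.smul_apply, smul_eq_mul, ← Finset.mul_sum]
    exact inv_mul_cancel₀ hs.ne'
  · have hle : vanishing e V ⊔ Submodule.span ℝ {s⁻¹ • g} ≤ vanishing e F :=
      sup_le (vanishing_anti hFV) (by simpa using hg0)
    refine (Submodule.eq_of_le_of_finrank_le hle ?_).ge
    have hlt : vanishing e V < vanishing e V ⊔ Submodule.span ℝ {s⁻¹ • g} := by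
      refine lt_of_le_of_ne le_sup_left fun h => ?_
      have : s⁻¹ • g ∈ vanishing e V := h ▸ Submodule.mem_sup_right
        (Submodule.mem_span_singleton_self _)
      have := this v hv
      simp [hs.ne', (gpos v hv hvF).ne'] at this
    have := Submodule.finrank_lt_finrank_of_lt hlt
    unfold corank at hc
    omega

lemma choose_add_choose_lt {a b m : ℕ} (ha : 1 ≤ a) (hb : 1 ≤ b) (hm : 2 ≤ m) (hmab : m ≤ a + b) :
    a.choose m + b.choose m < (a + b).choose m := by
  obtain ⟨m, rfl⟩ : ∃ l, m = l + 1 := ⟨m - 1, by omega⟩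
  induction b, hb using Nat.le_induction with
  | base =>
    have : 0 < a.choose m := Nat.choose_pos (by omega)
    rw [Nat.choose_succ_succ' a, Nat.choose_eq_zero_of_lt (show 1 < m + 1 by omega)]
    omega
  | succ b hb ih =>
    rcases hmab.lt_or_eq with h | h
    · have := ih (by omega)
      rw [← add_assoc, Nat.choose_succ_succ' (a + b), Nat.choose_succ_succ' b]
      have := Nat.choose_le_choose m (show b ≤ a + b by omega)
      omega
    · rw [← h, Nat.choose_self, Nat.choose_eq_zero_of_lt (by omega),
        Nat.choose_eq_zero_of_lt (by omega)]
      omega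

lemma choose_half_add_choose_half_le {a b d : ℕ} (m : ℕ) (h : d ≤ a + b) :
    ((d + 1) / 2).choose m + (d / 2).choose m ≤ a.choose m + b.choose m := by
  wlog hab : b ≤ a generalizing a b
  · rw [add_comm (a.choose m)]
    exact this (by omega) (by omega)
  by_cases h1 : d / 2 ≤ b
  · exact add_le_add (Nat.choose_le_choose m (by omega)) (Nat.choose_le_choose m h1)
  · obtain ⟨n, hn⟩ : ∃ n, n = d / 2 - b := ⟨_, rfl⟩
    induction n generalizing a b with
    | zero => omega
    | succ n ih =>
      obtain ⟨a, rfl⟩ : ∃ a', a = a' + 1 := ⟨a - 1, by omega⟩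
      have key : a.choose m + (b + 1).choose m ≤ (a + 1).choose m + b.choose m := by
        rcases m with _ | m
        · simp
        · rw [Nat.choose_succ_succ' b, Nat.choose_succ_succ' a]
          have := Nat.choose_le_choose m (show b ≤ a by omega)
          omega
      refine le_trans ?_ key
      by_cases h2 : d / 2 ≤ b + 1
      · exact add_le_add (Nat.choose_le_choose m (by omega)) (Nat.choose_le_choose m h2)
      · exact ih (by omega) (by omega) (by omega) (by omega)

lemma corank_empty (e : L →ₗ[ℝ] α → ℝ) : corank e ∅ = Module.finrank ℝ L := by
  have : vanishing e ∅ = ⊤ := by ext; simp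
  rw [corank, this, finrank_top]

lemma isVFace_empty {c₀ : L} (hc₀ : ∀ v ∈ V, 0 < e c₀ v) : IsVFace e V ∅ :=
  ⟨Finset.empty_subset _, c₀, by simp, fun v hv _ => hc₀ v hv⟩

open Classical in
/-- The faces of relative corank `c` contained in `F` for which `F` maximizes `u` among the facets
containing them. -/
def selectedFaces (e : L →ₗ[ℝ] α → ℝ) (V : Finset α) (c : ℕ) (u : Finset α → ℝ) (F : Finset α) :
    Finset (Finset α) :=
  {T ∈ facesAbove e V ∅ c | T ⊆ F ∧ ∀ F' ∈ facesAbove e V ∅ 1, F' ≠ F → T ⊆ F' → u F' < u F}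

lemma sum_card_selectedFaces_le (e : L →ₗ[ℝ] α → ℝ) (V : Finset α) (c : ℕ)
    (u : Finset α → ℝ) :
    ∑ F ∈ facesAbove e V ∅ 1, (selectedFaces e V c u F).card ≤ (facesAbove e V ∅ c).card := by
  classical
  rw [← Finset.card_biUnion]
  · refine Finset.card_le_card (Finset.biUnion_subset.2 fun F _ => Finset.filter_subset _ _)
  · intro F hF F' hF' hne
    rw [Function.onFun, Finset.disjoint_left]
    intro T hT hT'
    simp only [selectedFaces, Finset.mem_filter] at hT hT'
    exact lt_asymm (hT.2.2 F' hF' hne.symm hT'.2.1) (hT'.2.2 F hF hne hT.2.1)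

lemma card_facesAbove_le_card_selectedFaces {m : ℕ} {u : Finset α → ℝ}
    (hF : F ∈ facesAbove e V ∅ 1) (A : Finset α)
    (h : ∀ F' ∈ facesAbove e V ∅ 1, F' ≠ F → A ⊆ F' → u F' < u F) :
    (facesAbove e F A m).card ≤ (selectedFaces e V (m + 1) u F).card := by
  classical
  refine Finset.card_le_card fun T hT => ?_
  rw [mem_facesAbove] at hF hT
  simp only [selectedFaces, Finset.mem_filter, mem_facesAbove]
  refine ⟨⟨hF.1.trans hT.1, by simp, by omega⟩, hT.1.1, fun F' hF' hne hTF' => ?_⟩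
  exact h F' (mem_facesAbove.2 hF') hne (hT.2.1.trans hTF')

/-- Some ranking `u` of the facets selects many faces at each facet, from above and from below. -/
lemma exists_ranking [FiniteDimensional ℝ L] {c₀ : L} (hc₀ : ∀ v ∈ V, 0 < e c₀ v) {d : ℕ}
    (hd : Module.finrank ℝ L = corank e V + d + 1) :
    ∃ u : Finset α → ℝ,
      (∀ F ∈ facesAbove e V ∅ 1, ∀ F' ∈ facesAbove e V ∅ 1, F ≠ F' → u F ≠ u F') ∧
      ∀ m, ∀ F ∈ facesAbove e V ∅ 1, ((d + 1) / 2).choose m + (d / 2).choose m ≤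
        (selectedFaces e V (m + 1) u F).card + (selectedFaces e V (m + 1) (-u) F).card := by
  classical
  have hex : ∀ F ∈ facesAbove e V ∅ 1, ∃ g : L, (∀ v ∈ F, e g v = 0) ∧
      (∀ v ∈ V, v ∉ F → 0 < e g v) ∧ ∑ v ∈ V, e g v = 1 ∧
      vanishing e F ≤ vanishing e V ⊔ Submodule.span ℝ {g} := fun F hF =>
    exists_facet_normal (mem_facesAbove.1 hF).1 (mem_facesAbove.1 hF).2.2
  choose! G hG0 hGpos hGsum hGspan using hex
  obtain ⟨y, hyV, hy⟩ : ∃ y : Module.Dual ℝ L, (∀ g ∈ vanishing e V, y g = 0) ∧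
      ∀ F ∈ facesAbove e V ∅ 1, ∀ F' ∈ facesAbove e V ∅ 1, F ≠ F' → y (G F) ≠ y (G F') := by
    let ι := {q : facesAbove e V ∅ 1 × facesAbove e V ∅ 1 // q.1 ≠ q.2}
    obtain ⟨ψ, hψ⟩ := Module.exists_dual_forall_apply_ne_zero (K := ℝ)
      (fun q : ι => (vanishing e V).mkQ (G q.1.1 - G q.1.2)) (by
        rintro ⟨⟨⟨F, hF⟩, F', hF'⟩, hne⟩
        simp only [ne_eq, Submodule.mkQ_apply, Submodule.Quotient.mk_eq_zero]
        intro h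
        have hv : ∀ v ∈ V, e (G F) v = e (G F') v := fun v hv => by
          have := h v hv
          simpa [sub_eq_zero] using this
        refine hne (Subtype.ext ?_)
        have hFV := (mem_facesAbove.1 hF).1.1
        have hFV' := (mem_facesAbove.1 hF').1.1
        ext v
        constructor
        · intro hvF
          by_contra hvF'
          have := hGpos F' hF' v (hFV hvF) hvF'
          rw [← hv v (hFV hvF), hG0 F hF v hvF] at this
          exact this.false
        · intro hvF'
          by_contra hvF
          have := hGpos F hF v (hFV' hvF') hvF
          rw [hv v (hFV' hvF'), hG0 F' hF' v hvF'] at this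
          exact this.false)
    refine ⟨ψ ∘ₗ (vanishing e V).mkQ, fun g hg => ?_, fun F hF F' hF' hne heq => ?_⟩
    · have : (vanishing e V).mkQ g = 0 := by simpa using hg
      simp only [LinearMap.comp_apply, this, map_zero]
    · refine hψ ⟨⟨⟨F, hF⟩, F', hF'⟩, by simpa using hne⟩ ?_
      simp only [LinearMap.comp_apply] at heq
      rw [map_sub, map_sub, heq, sub_self]
  refine ⟨fun F => y (G F), hy, fun m F hF => ?_⟩
  let o : Module.Dual ℝ L := ∑ v ∈ V, LinearMap.proj v ∘ₗ e
  have ho : ∀ g, o g = ∑ v ∈ V, e g v := fun g => by simp [o]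
  let z := y - y (G F) • o
  have hzG : ∀ F' ∈ facesAbove e V ∅ 1, z (G F') = y (G F') - y (G F) := fun F' hF' => by
    simp [z, ho, hGsum F' hF']
  have hz : ∀ g ∈ vanishing e F, z g = 0 := by
    intro g hg
    obtain ⟨g₁, hg₁, g₂, hg₂, rfl⟩ := Submodule.mem_sup.1 (hGspan F hF hg)
    obtain ⟨r, rfl⟩ := Submodule.mem_span_singleton.1 hg₂
    have : z g₁ = 0 := by
      simp [z, hyV g₁ hg₁, ho, Finset.sum_eq_zero hg₁]
    rw [map_add, this, map_smul, hzG F hF, sub_self, smul_zero, add_zero]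
  have hF' := mem_facesAbove.1 hF
  obtain ⟨A, B, hA, hB, hAB, hzA, hzB⟩ :=
    exists_complementary_faces (fun v hv => hc₀ v (hF'.1.1 hv)) hz
  have hnn : ∀ F' ∈ facesAbove e V ∅ 1, ∀ v ∈ F, 0 ≤ e (G F') v := fun F' h v hv =>
    IsVFace.nonneg (hG0 F' h) (hGpos F' h) (hF'.1.1 hv)
  have h1 := (hA.choose_le_card_facesAbove m).trans
    (card_facesAbove_le_card_selectedFaces (u := fun F => y (G F)) hF A fun F' h hne hAF' => by
      have := hzA _ (hnn F' h) fun v hv => hG0 F' h v (hAF' hv)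
      rw [hzG F' h] at this
      exact lt_of_le_of_ne (by linarith) (hy F' h F hF hne))
  have h2 := (hB.choose_le_card_facesAbove m).trans
    (card_facesAbove_le_card_selectedFaces (u := -fun F => y (G F)) hF B fun F' h hne hBF' => by
      have := hzB _ (hnn F' h) fun v hv => hG0 F' h v (hBF' hv)
      rw [hzG F' h] at this
      exact neg_lt_neg (lt_of_le_of_ne (by linarith) (hy F hF F' h hne.symm)))
  refine (choose_half_add_choose_half_le m ?_).trans (add_le_add h1 h2)
  have := hF'.2.2
  have := corank_anti (e := e) hA.1
  have := corank_anti (e := e) hB.1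
  omega

theorem card_facets_mul_lt [FiniteDimensional ℝ L] {c₀ : L} (hc₀ : ∀ v ∈ V, 0 < e c₀ v)
    {d m : ℕ} (hd : Module.finrank ℝ L = corank e V + d + 1) (hm : 2 ≤ m) (hmd : m ≤ d) :
    (((d + 1) / 2).choose m + (d / 2).choose m) * (facesAbove e V ∅ 1).card <
      2 * (facesAbove e V ∅ (m + 1)).card := by
  classical
  obtain ⟨u, hu, hsel⟩ := exists_ranking hc₀ hd
  have hne : (facesAbove e V ∅ 1).Nonempty := by
    have : V.Nonempty := by
      rw [Finset.nonempty_iff_ne_empty]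
      rintro rfl
      rw [corank_empty] at hd
      omega
    obtain ⟨v, hv⟩ := this
    obtain ⟨K, h1, h2, -, h4⟩ := (isVFace_empty hc₀).exists_coatom hv (by simp)
    exact ⟨K, mem_facesAbove.2 ⟨h1, h2, h4⟩⟩
  obtain ⟨F, hF, hmax⟩ := Finset.exists_max_image _ u hne
  have hlt : ((d + 1) / 2).choose m + (d / 2).choose m <
      (selectedFaces e V (m + 1) u F).card + (selectedFaces e V (m + 1) (-u) F).card := by
    have h1 := card_facesAbove_le_card_selectedFaces (m := m) (u := u) hF ∅ fun F' h hne _ =>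
      lt_of_le_of_ne (hmax F' h) (hu F' h F hF hne)
    have hF' := mem_facesAbove.1 hF
    have h2 := (isVFace_empty fun v hv => hc₀ v (hF'.1.1 hv)).choose_le_card_facesAbove m
    rw [corank_empty, show Module.finrank ℝ L - corank e F = (d + 1) / 2 + d / 2 by omega] at h2
    have := choose_add_choose_lt (a := (d + 1) / 2) (b := d / 2) (m := m) (by omega) (by omega) hm
      (by omega)
    omega
  calc _ = ∑ F ∈ facesAbove e V ∅ 1, (((d + 1) / 2).choose m + (d / 2).choose m) := by
        rw [Finset.sum_const, smul_eq_mul, mul_comm]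
    _ < ∑ F ∈ facesAbove e V ∅ 1, ((selectedFaces e V (m + 1) u F).card +
          (selectedFaces e V (m + 1) (-u) F).card) :=
        Finset.sum_lt_sum (hsel m) ⟨F, hF, hlt⟩
    _ ≤ _ := by
        rw [Finset.sum_add_distrib, two_mul]
        exact add_le_add (sum_card_selectedFaces_le ..) (sum_card_selectedFaces_le ..)

lemma facet_eq_of_nonneg_combination [FiniteDimensional ℝ L] {g₁ g₂ g₃ : L} {F₁ F₃ : Finset α}
    (h₁ : F₁ ∈ facesAbove e V ∅ 1) (h₃ : F₃ ∈ facesAbove e V ∅ 1)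
    (p₁ : ∀ v ∈ V, v ∉ F₁ → 0 < e g₁ v) (p₂ : ∀ v ∈ V, 0 ≤ e g₂ v)
    (z₃ : ∀ v ∈ F₃, e g₃ v = 0) {a b c : ℝ} (ha : 0 < a) (hb : 0 ≤ b)
    (h : ∀ v ∈ V, a * e g₁ v + b * e g₂ v = c * e g₃ v) : F₃ = F₁ := by
  rw [mem_facesAbove] at h₁ h₃
  refine h₃.1.eq_of_subset h₁.1 (fun v hv => ?_) (by omega)
  by_contra hv'
  have h4 := h v (h₃.1.1 hv)
  rw [z₃ v hv] at h4
  have h5 := mul_pos ha (p₁ v (h₃.1.1 hv) hv')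
  have h6 := mul_nonneg hb (p₂ v (h₃.1.1 hv))
  linarith

lemma facet_eq_or_eq_of_relation [FiniteDimensional ℝ L] {g₁ g₂ g₃ : L} {F₁ F₂ F₃ : Finset α}
    (h₁ : F₁ ∈ facesAbove e V ∅ 1) (h₂ : F₂ ∈ facesAbove e V ∅ 1) (h₃ : F₃ ∈ facesAbove e V ∅ 1)
    (z₁ : ∀ v ∈ F₁, e g₁ v = 0) (z₂ : ∀ v ∈ F₂, e g₂ v = 0) (z₃ : ∀ v ∈ F₃, e g₃ v = 0)
    (p₁ : ∀ v ∈ V, v ∉ F₁ → 0 < e g₁ v) (p₂ : ∀ v ∈ V, v ∉ F₂ → 0 < e g₂ v)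
    (p₃ : ∀ v ∈ V, v ∉ F₃ → 0 < e g₃ v) {a b c : ℝ} (ha : a ≠ 0)
    (h : ∀ v ∈ V, a * e g₁ v + b * e g₂ v + c * e g₃ v = 0) : F₃ = F₁ ∨ F₂ = F₁ := by
  wlog hpos : 0 < a generalizing a b c
  · exact this (a := -a) (b := -b) (c := -c) (neg_ne_zero.2 ha)
      (fun v hv => by linarith [h v hv])
      (neg_pos.2 (lt_of_le_of_ne (not_lt.1 hpos) ha))
  have n₂ : ∀ v ∈ V, 0 ≤ e g₂ v := fun v hv => IsVFace.nonneg z₂ p₂ hv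
  have n₃ : ∀ v ∈ V, 0 ≤ e g₃ v := fun v hv => IsVFace.nonneg z₃ p₃ hv
  rcases le_or_gt 0 b with hb | hb
  · exact .inl (facet_eq_of_nonneg_combination (c := -c) h₁ h₃ p₁ n₂ z₃ hpos hb
      fun v hv => by linarith [h v hv])
  rcases le_or_gt 0 c with hc | hc
  · exact .inr (facet_eq_of_nonneg_combination (c := -b) h₁ h₂ p₁ n₃ z₂ hpos hc
      fun v hv => by linarith [h v hv])
  · exact .inr (facet_eq_of_nonneg_combination (a := -b) (b := -c) (c := a) h₂ h₁ p₂ n₃ z₁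
      (neg_pos.2 hb) (neg_pos.2 hc).le fun v hv => by linarith [h v hv]).symm

open Classical in
lemma card_facets_above_ridge [FiniteDimensional ℝ L] {R : Finset α}
    (hR : R ∈ facesAbove e V ∅ 2) : {F ∈ facesAbove e V ∅ 1 | R ⊆ F}.card = 2 := by
  rw [mem_facesAbove] at hR
  obtain ⟨hR, -, hcR⟩ := hR
  have hne : ¬ V ⊆ R := fun h => by have := corank_anti (e := e) h; omega
  obtain ⟨v, hv, hvR⟩ := Finset.not_subset.1 hne
  obtain ⟨K₁, hK₁, hRK₁, -, hc₁⟩ := hR.exists_coatom hv hvR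
  have hne : ¬ K₁ ⊆ R := fun h => by have := corank_anti (e := e) h; omega
  obtain ⟨w, hw, hwR⟩ := Finset.not_subset.1 hne
  obtain ⟨K₂, hK₂, hRK₂, hwK₂, hc₂⟩ := hR.exists_coatom (hK₁.1 hw) hwR
  have hK₁₂ : K₁ ≠ K₂ := fun h => hwK₂ (h ▸ hw)
  have m₁ : K₁ ∈ facesAbove e V ∅ 1 := mem_facesAbove.2 ⟨hK₁, by simp, hc₁⟩
  have m₂ : K₂ ∈ facesAbove e V ∅ 1 := mem_facesAbove.2 ⟨hK₂, by simp, hc₂⟩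
  have : {F ∈ facesAbove e V ∅ 1 | R ⊆ F} = {K₁, K₂} := by
    ext K₃
    simp only [Finset.mem_filter, Finset.mem_insert, Finset.mem_singleton]
    constructor
    swap
    · rintro (rfl | rfl)
      · exact ⟨m₁, hRK₁⟩
      · exact ⟨m₂, hRK₂⟩
    rintro ⟨m₃, hRK₃⟩
    obtain ⟨hK₃, -, hc₃⟩ := mem_facesAbove.1 m₃
    obtain ⟨g₁, z₁, p₁, -, -⟩ := exists_facet_normal hK₁ hc₁
    obtain ⟨g₂, z₂, p₂, -, -⟩ := exists_facet_normal hK₂ hc₂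
    obtain ⟨g₃, z₃, p₃, -, -⟩ := exists_facet_normal hK₃ hc₃
    obtain ⟨a, b, c, hrel, hnz⟩ : ∃ a b c : ℝ,
        (∀ v ∈ V, a * e g₁ v + b * e g₂ v + c * e g₃ v = 0) ∧ (a ≠ 0 ∨ b ≠ 0 ∨ c ≠ 0) := by
      have hVR : vanishing e V ≤ vanishing e R := vanishing_anti hR.1
      let U := (vanishing e V).submoduleOf (vanishing e R)
      have hU : Module.finrank ℝ U = corank e V :=
        (Submodule.submoduleOfEquivOfLe hVR).finrank_eq
      have hq : Module.finrank ℝ (vanishing e R ⧸ U) = 2 := by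
        have := U.finrank_quotient_add_finrank
        unfold corank at *
        omega
      let x : Fin 3 → vanishing e R := ![⟨g₁, fun v hv => z₁ v (hRK₁ hv)⟩,
        ⟨g₂, fun v hv => z₂ v (hRK₂ hv)⟩, ⟨g₃, fun v hv => z₃ v (hRK₃ hv)⟩]
      have hdep : ¬ LinearIndependent ℝ (fun i => U.mkQ (x i)) := fun h => by
        have := h.fintype_card_le_finrank
        simp [hq] at this
      rw [Fintype.not_linearIndependent_iff] at hdep
      obtain ⟨q, hsum, i, hi⟩ := hdep
      refine ⟨q 0, q 1, q 2, fun v hv => ?_, ?_⟩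
      · have : U.mkQ (∑ i, q i • x i) = 0 := by simpa using hsum
        rw [Submodule.mkQ_apply, Submodule.Quotient.mk_eq_zero] at this
        have h3 : ((∑ i, q i • x i : vanishing e R) : L) ∈ vanishing e V := this
        have := h3 v hv
        simpa [Fin.sum_univ_three, x] using this
      · fin_cases i
        · exact .inl hi
        · exact .inr (.inl hi)
        · exact .inr (.inr hi)
    rcases hnz with hnz | hnz | hnz
    · rcases facet_eq_or_eq_of_relation m₁ m₂ m₃ z₁ z₂ z₃ p₁ p₂ p₃ hnz hrel with h | h
      · exact .inl h
      · exact absurd h.symm hK₁₂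
    · rcases facet_eq_or_eq_of_relation (b := a) (c := c) m₂ m₁ m₃ z₂ z₁ z₃ p₂ p₁ p₃ hnz
        (fun v hv => by linarith [hrel v hv]) with h | h
      · exact .inr h
      · exact absurd h hK₁₂
    · rcases facet_eq_or_eq_of_relation (b := a) (c := b) m₃ m₁ m₂ z₃ z₁ z₂ p₃ p₁ p₂ hnz
        (fun v hv => by linarith [hrel v hv]) with h | h
      · exact .inr h.symm
      · exact .inl h.symm
  rw [this, Finset.card_pair hK₁₂]

lemma card_le_card_of_separating {ι κ : Type*} (S : Finset ι) (T : Finset κ) (r : ι → κ → Prop)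
    (hex : ∀ a ∈ S, ∃ b ∈ T, r a b)
    (huniq : ∀ a ∈ S, ∀ b ∈ T, ∀ b' ∈ T, r a b → r a b' → b = b')
    (hsep : ∀ a ∈ S, ∀ a' ∈ S, a ≠ a' → ∃ b ∈ T, r a' b ∧ ¬ r a b) : S.card ≤ T.card := by
  rcases S.eq_empty_or_nonempty with rfl | ⟨a₀, ha₀⟩
  · simp
  have : Nonempty κ := ⟨(hex a₀ ha₀).choose⟩
  choose! f hfT hf using hex
  refine Finset.card_le_card_of_injOn f hfT fun a ha a' ha' h => ?_
  by_contra hne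
  obtain ⟨b, hb, h1, h2⟩ := hsep a ha a' ha' hne
  exact h2 (huniq a' ha' b hb (f a') (hfT a' ha') h1 (hf a' ha') ▸ h ▸ hf a ha)

lemma eq_of_card_le_filter {κ : Type*} {T : Finset κ} {p : κ → Prop} [DecidablePred p]
    (h : T.card ≤ {b ∈ T | p b}.card + 1) {b b' : κ} (hb : b ∈ T) (hb' : b' ∈ T) (hpb : ¬ p b)
    (hpb' : ¬ p b') : b = b' := by
  have : {b ∈ T | p b}.card + {b ∈ T | ¬ p b}.card = T.card :=
    Finset.card_filter_add_card_filter_not p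
  exact Finset.card_le_one.1 (by omega : {b ∈ T | ¬ p b}.card ≤ 1) b (by simp [hb, hpb]) b'
    (by simp [hb', hpb'])

section simplex

variable [FiniteDimensional ℝ L] {c₀ : L} {d : ℕ}

lemma card_facesAbove_of_card_facets_eq (hc₀ : ∀ v ∈ F, 0 < e c₀ v) (hd : 1 ≤ d)
    (hr : Module.finrank ℝ L = corank e F + d) (h : (facesAbove e F ∅ 1).card = d) :
    (facesAbove e F ∅ (d - 1)).card = d := by
  classical
  have hE : IsVFace e F ∅ := isVFace_empty hc₀
  have hEc : corank e (∅ : Finset α) = corank e F + d := by rw [corank_empty, hr]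
  refine le_antisymm ?_ ?_
  · conv_rhs => rw [← h]
    refine card_le_card_of_separating _ _ (fun A K => ¬ A ⊆ K) ?_ ?_ ?_
    · intro A hA
      rw [mem_facesAbove] at hA
      have hne : ¬ A ⊆ ∅ := fun hA' => by
        have := corank_anti (e := e) hA'
        omega
      obtain ⟨v, hv, -⟩ := Finset.not_subset.1 hne
      obtain ⟨K, hK, -, hvK, hcK⟩ := hE.exists_coatom (hA.1.1 hv) (Finset.notMem_empty v)
      exact ⟨K, mem_facesAbove.2 ⟨hK, by simp, hcK⟩, fun hAK => hvK (hAK hv)⟩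
    · intro A hA K hK K' hK' hAK hAK'
      rw [mem_facesAbove] at hA
      refine eq_of_card_le_filter (p := fun K => A ⊆ K) ?_ hK hK' hAK hAK'
      have h1 : facesAbove e F A 1 ⊆ {K ∈ facesAbove e F ∅ 1 | A ⊆ K} := by
        intro K hK
        rw [mem_facesAbove] at hK
        rw [Finset.mem_filter, mem_facesAbove]
        exact ⟨⟨hK.1, by simp, hK.2.2⟩, hK.2.1⟩
      have h2 := (hA.1.choose_le_card_facesAbove 1).trans (Finset.card_le_card h1)
      rw [Nat.choose_one_right] at h2
      omega
    · intro A hA A' hA' hne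
      rw [mem_facesAbove] at hA hA'
      have hsub : ¬ A' ⊆ A := fun hs => hne (hA'.1.eq_of_subset hA.1 hs (by omega)).symm
      obtain ⟨v, hv, hvA⟩ := Finset.not_subset.1 hsub
      obtain ⟨K, hK, hAK, hvK, hcK⟩ := hA.1.exists_coatom (hA'.1.1 hv) hvA
      exact ⟨K, mem_facesAbove.2 ⟨hK, by simp, hcK⟩, fun hs => hvK (hs hv), not_not.2 hAK⟩
  · have := hE.choose_le_card_facesAbove (d - 1)
    rwa [hEc, Nat.add_sub_cancel_left, Nat.choose_symm hd, Nat.choose_one_right] at this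

lemma card_facets_of_card_facesAbove_eq (hc₀ : ∀ v ∈ F, 0 < e c₀ v) (hd : 1 ≤ d)
    (hr : Module.finrank ℝ L = corank e F + d) (h : (facesAbove e F ∅ (d - 1)).card = d) :
    (facesAbove e F ∅ 1).card = d := by
  classical
  have hE : IsVFace e F ∅ := isVFace_empty hc₀
  have hEc : corank e (∅ : Finset α) = corank e F + d := by rw [corank_empty, hr]
  have hone := hE.choose_le_card_facesAbove 1
  rw [hEc, Nat.add_sub_cancel_left, Nat.choose_one_right] at hone
  refine le_antisymm ?_ hone
  conv_rhs => rw [← h]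
  have hatom : ∀ K, IsVFace e F K → K ≠ F → ∃ A ∈ facesAbove e F ∅ (d - 1), ¬ A ⊆ K := by
    intro K hK hKF
    obtain ⟨A, hA, -, hAK, hcA⟩ := hE.exists_atom hK (Finset.empty_subset K) hKF
    exact ⟨A, mem_facesAbove.2 ⟨hA, by simp, by omega⟩, hAK⟩
  refine card_le_card_of_separating _ _ (fun K A => ¬ A ⊆ K) ?_ ?_ ?_
  · intro K hK
    rw [mem_facesAbove] at hK
    refine hatom K hK.1 fun hKF => ?_
    have := hK.2.2
    rw [hKF] at this
    omega
  · intro K hK A hA A' hA' hAK hAK'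
    rw [mem_facesAbove] at hK
    refine eq_of_card_le_filter (p := fun A => A ⊆ K) ?_ hA hA' hAK hAK'
    rcases Nat.lt_or_ge d 2 with hd2 | hd2
    · omega
    have h1 : facesAbove e K ∅ (d - 2) ⊆ {A ∈ facesAbove e F ∅ (d - 1) | A ⊆ K} := by
      intro A hA
      rw [mem_facesAbove] at hA
      rw [Finset.mem_filter, mem_facesAbove]
      exact ⟨⟨hK.1.trans hA.1, by simp, by omega⟩, hA.1.1⟩
    have h2 := ((hE.of_subset hK.1.1 (Finset.empty_subset K)).choose_le_card_facesAbove
      (d - 2)).trans (Finset.card_le_card h1)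
    rw [hEc, hK.2.2, show corank e F + d - (corank e F + 1) = d - 1 by omega,
      show d - 2 = d - 1 - 1 by omega, Nat.choose_symm (by omega), Nat.choose_one_right] at h2
    omega
  · intro K hK K' hK' hne
    rw [mem_facesAbove] at hK hK'
    have hsub : ¬ K ⊆ K' := fun hs => hne (hK.1.eq_of_subset hK'.1 hs (by omega))
    have hEK := hE.of_subset hK.1.1 (Finset.empty_subset K)
    obtain ⟨A, hA, -, hAK, hcA⟩ := hEK.exists_atom
      ((hK.1.inter hK'.1).of_subset hK.1.1 Finset.inter_subset_left)
      (Finset.empty_subset _) (fun h => hsub (Finset.inter_eq_left.1 h))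
    exact ⟨A, mem_facesAbove.2 ⟨hK.1.trans hA, by simp, by omega⟩,
      fun h => hAK (Finset.subset_inter hA.1 h), not_not.2 hA.1⟩

lemma card_facets_eq_iff (hc₀ : ∀ v ∈ F, 0 < e c₀ v) (hd : 1 ≤ d)
    (hr : Module.finrank ℝ L = corank e F + d) :
    (facesAbove e F ∅ 1).card = d ↔ (facesAbove e F ∅ (d - 1)).card = d :=
  ⟨card_facesAbove_of_card_facets_eq hc₀ hd hr, card_facets_of_card_facesAbove_eq hc₀ hd hr⟩

lemma sum_card_facets_facets (e : L →ₗ[ℝ] α → ℝ) (V : Finset α) :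
    ∑ F ∈ facesAbove e V ∅ 1, (facesAbove e F ∅ 1).card = 2 * (facesAbove e V ∅ 2).card := by
  classical
  have h := Finset.sum_card_bipartiteAbove_eq_sum_card_bipartiteBelow
    (s := facesAbove e V ∅ 1) (t := facesAbove e V ∅ 2) (fun F R => R ⊆ F)
  rw [Finset.sum_congr rfl (fun R hR => by
    rw [← card_facets_above_ridge hR]
    congr 1 :
    ∀ R ∈ facesAbove e V ∅ 2, (Finset.bipartiteBelow (fun F R => R ⊆ F) (facesAbove e V ∅ 1)
      R).card = 2), Finset.sum_const, smul_eq_mul, mul_comm] at h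
  rw [← h]
  refine Finset.sum_congr rfl fun F hF => congrArg Finset.card ?_
  rw [mem_facesAbove] at hF
  ext R
  rw [Finset.mem_bipartiteAbove, mem_facesAbove, mem_facesAbove]
  constructor
  · rintro ⟨hR, -, hc⟩
    exact ⟨⟨hF.1.trans hR, by simp, by omega⟩, hR.1⟩
  · rintro ⟨⟨hR, -, hc⟩, hRF⟩
    exact ⟨hR.of_subset hF.1.1 hRF, by simp, by omega⟩

theorem two_mul_card_ridges_eq_iff (hc₀ : ∀ v ∈ V, 0 < e c₀ v) (hd : 1 ≤ d)
    (hr : Module.finrank ℝ L = corank e V + d + 1) :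
    2 * (facesAbove e V ∅ 2).card = d * (facesAbove e V ∅ 1).card ↔
      ∀ F ∈ facesAbove e V ∅ 1, (facesAbove e F ∅ (d - 1)).card = d := by
  have hrank : ∀ F ∈ facesAbove e V ∅ 1, Module.finrank ℝ L = corank e F + d := fun F hF => by
    rw [mem_facesAbove] at hF
    omega
  have hpos : ∀ F ∈ facesAbove e V ∅ 1, ∀ v ∈ F, 0 < e c₀ v := fun F hF v hv =>
    hc₀ v ((mem_facesAbove.1 hF).1.1 hv)
  have hle : ∀ F ∈ facesAbove e V ∅ 1, d ≤ (facesAbove e F ∅ 1).card := fun F hF => by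
    have := (isVFace_empty (hpos F hF)).choose_le_card_facesAbove 1
    rwa [corank_empty, hrank F hF, Nat.add_sub_cancel_left, Nat.choose_one_right] at this
  have hsum := Finset.sum_eq_sum_iff_of_le hle
  rw [sum_card_facets_facets, Finset.sum_const, smul_eq_mul, mul_comm _ d, eq_comm] at hsum
  rw [hsum]
  exact forall₂_congr fun F hF => by
    rw [← card_facets_eq_iff (hpos F hF) hd (hrank F hF), eq_comm]

end simplex

section polytope

variable {E : Type*} [NormedAddCommGroup E] [InnerProductSpace ℝ E]

/-- The pair `(f, c)` regarded as the affine function `x ↦ f x + c`. -/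
def affineEval (E : Type*) [NormedAddCommGroup E] [InnerProductSpace ℝ E] :
    (Module.Dual ℝ E × ℝ) →ₗ[ℝ] E → ℝ where
  toFun g x := g.1 x + g.2
  map_add' g h := by
    ext x
    simp only [Prod.fst_add, Prod.snd_add, LinearMap.add_apply, Pi.add_apply]
    ring
  map_smul' c g := by
    ext x
    simp [mul_add]

@[simp] lemma affineEval_apply (g : Module.Dual ℝ E × ℝ) (x : E) :
    affineEval E g x = g.1 x + g.2 := rfl

lemma corank_affineEval_add_finrank [FiniteDimensional ℝ E] {T : Finset E} (hT : T.Nonempty) :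
    corank (affineEval E) T + Module.finrank ℝ (vectorSpan ℝ (T : Set E)) =
      Module.finrank ℝ E := by
  obtain ⟨p, hp⟩ := hT
  let φ : vanishing (affineEval E) T →ₗ[ℝ] Module.Dual ℝ E :=
    LinearMap.fst ℝ (Module.Dual ℝ E) ℝ ∘ₗ (vanishing (affineEval E) T).subtype
  have hinj : Function.Injective φ := by
    rintro ⟨⟨f, c⟩, hg⟩ ⟨⟨f', c'⟩, hg'⟩ (rfl : f = f')
    have h1 := hg p hp
    have h2 := hg' p hp
    simp only [affineEval_apply] at h1 h2
    have : c = c' := by linarith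
    subst this
    rfl
  have hrange : LinearMap.range φ = (vectorSpan ℝ (T : Set E)).dualAnnihilator := by
    rw [vectorSpan_eq_span_vsub_set_right ℝ (Finset.mem_coe.2 hp)]
    ext f
    simp only [Submodule.mem_dualAnnihilator, LinearMap.mem_range]
    constructor
    · rintro ⟨⟨⟨f, c⟩, hg⟩, rfl⟩ w hw
      induction hw using Submodule.span_induction with
      | mem w hw =>
        obtain ⟨v, hv, rfl⟩ := hw
        have h1 := hg v hv
        have h2 := hg p hp
        simp only [affineEval_apply] at h1 h2
        change f (v - p) = 0
        rw [map_sub]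
        linarith
      | zero => simp
      | add x y _ _ hx hy => rw [map_add, hx, hy, add_zero]
      | smul a x _ hx => rw [map_smul, hx, smul_zero]
    · intro hf
      refine ⟨⟨(f, -f p), fun v hv => ?_⟩, rfl⟩
      have := hf (v -ᵥ p) (Submodule.subset_span ⟨v, hv, rfl⟩)
      rw [vsub_eq_sub, map_sub] at this
      simpa [sub_eq_add_neg] using this
  rw [corank, ← LinearMap.finrank_range_of_inj hinj, hrange, add_comm]
  exact Subspace.finrank_add_finrank_dualAnnihilator_eq _

lemma corank_affineEval_add_dimSet [FiniteDimensional ℝ E] {T : Finset E} (hT : T.Nonempty) :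
    corank (affineEval E) T + dimSet (convexHull ℝ (T : Set E)) = Module.finrank ℝ E := by
  rw [dimSet, affineSpan_convexHull, direction_affineSpan]
  exact corank_affineEval_add_finrank hT

lemma convexHull_zeros_eq {V T : Finset E} {g : Module.Dual ℝ E × ℝ} (hTV : T ⊆ V)
    (h0 : ∀ v ∈ T, affineEval E g v = 0) (hpos : ∀ v ∈ V, v ∉ T → 0 < affineEval E g v) :
    {x ∈ convexHull ℝ (V : Set E) | affineEval E g x = 0} = convexHull ℝ (T : Set E) := by
  have key : ∀ (w : E → ℝ) (S : Finset E), ∑ v ∈ S, w v = 1 →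
      affineEval E g (∑ v ∈ S, w v • v) = ∑ v ∈ S, w v * affineEval E g v := by
    intro w S hw
    simp [mul_add, Finset.sum_add_distrib, ← Finset.sum_mul, hw]
  ext x
  constructor
  · rintro ⟨hx, hgx⟩
    obtain ⟨w, hw, hw1, rfl⟩ := Finset.mem_convexHull'.1 hx
    rw [key w V hw1] at hgx
    have hnn : ∀ v ∈ V, 0 ≤ w v * affineEval E g v := fun v hv =>
      mul_nonneg (hw v hv) (IsVFace.nonneg h0 hpos hv)
    rw [Finset.sum_eq_zero_iff_of_nonneg hnn] at hgx
    have hz : ∀ v ∈ V, v ∉ T → w v = 0 := fun v hv hvT =>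
      (mul_eq_zero.1 (hgx v hv)).resolve_right (hpos v hv hvT).ne'
    refine Finset.mem_convexHull'.2 ⟨w, fun v hv => hw v (hTV hv), ?_, ?_⟩
    · rw [Finset.sum_subset hTV hz, hw1]
    · exact Finset.sum_subset hTV fun v hv hvT => by rw [hz v hv hvT, zero_smul]
  · intro hx
    refine ⟨convexHull_mono (by exact_mod_cast hTV) hx, ?_⟩
    obtain ⟨w, hw, hw1, rfl⟩ := Finset.mem_convexHull'.1 hx
    rw [key w T hw1]
    exact Finset.sum_eq_zero fun v hv => by rw [h0 v hv, mul_zero]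

open Classical in
lemma IsVFace.filter_mem_convexHull {V T : Finset E} (hT : IsVFace (affineEval E) V T) :
    {v ∈ V | v ∈ convexHull ℝ (T : Set E)} = T := by
  obtain ⟨hTV, g, h0, hpos⟩ := hT
  ext v
  rw [Finset.mem_filter, ← convexHull_zeros_eq hTV h0 hpos]
  constructor
  · rintro ⟨hv, -, hgv⟩
    by_contra hvT
    exact (hpos v hv hvT).ne' hgv
  · exact fun hv => ⟨hTV hv, subset_convexHull ℝ _ (hTV hv), h0 v hv⟩

lemma IsVFace.isFace_convexHull [FiniteDimensional ℝ E] {V T : Finset E}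
    (hT : IsVFace (affineEval E) V T) :
    IsFace (convexHull ℝ (V : Set E)) (convexHull ℝ (T : Set E)) := by
  obtain ⟨hTV, ⟨f, c⟩, h0, hpos⟩ := id hT
  rcases T.eq_empty_or_nonempty with rfl | ⟨p, hp⟩
  · exact .inr (.inl (by simp))
  by_cases hf : f = 0
  · refine .inl ?_
    have hc : c = 0 := by simpa [hf] using h0 p hp
    have : T = V := hTV.antisymm fun v hv => by
      by_contra hvT
      simpa [hf, hc] using hpos v hv hvT
    rw [this]
  refine .inr (.inr ⟨-LinearMap.toContinuousLinearMap f, ?_, c, ?_, ?_⟩)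
  · simpa using hf
  · intro x hx
    refine convexHull_min (t := {x | (-LinearMap.toContinuousLinearMap f) x ≤ c}) ?_
      (convex_halfSpace_le (LinearMap.isLinear (-f)) c) hx
    intro v hv
    have := IsVFace.nonneg h0 hpos hv
    rw [affineEval_apply] at this
    change -f v ≤ c
    linarith
  · rw [← convexHull_zeros_eq hTV h0 hpos]
    ext x
    simp only [Set.mem_ofPred_eq, affineEval_apply, neg_apply,
      LinearMap.coe_toContinuousLinearMap', and_congr_right_iff]
    intro _
    constructor <;> intro h <;> linarith

lemma exists_isVFace_of_isFace {V : Finset E} {G : Set E}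
    (hG : IsFace (convexHull ℝ (V : Set E)) G) (hne : G.Nonempty) :
    ∃ T, IsVFace (affineEval E) V T ∧ G = convexHull ℝ (T : Set E) := by
  classical
  rcases hG with rfl | rfl | ⟨f, -, c, hle, rfl⟩
  · exact ⟨V, .refl _ V, rfl⟩
  · exact absurd hne Set.not_nonempty_empty
  have hnn : ∀ v ∈ V, 0 ≤ affineEval E (-(f : Module.Dual ℝ E), c) v := fun v hv => by
    have := hle v (subset_convexHull ℝ _ hv)
    simpa using this
  have hT := isVFace_filter hnn
  refine ⟨_, hT, ?_⟩
  rw [← convexHull_zeros_eq (g := (-(f : Module.Dual ℝ E), c)) hT.1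
    (fun v hv => (Finset.mem_filter.1 hv).2) fun v hv hvT =>
      lt_of_le_of_ne (hnn v hv) fun h => hvT (Finset.mem_filter.2 ⟨hv, h.symm⟩)]
  ext x
  simp only [Set.mem_ofPred_eq, affineEval_apply, LinearMap.neg_apply,
    ContinuousLinearMap.coe_coe, and_congr_right_iff]
  intro _
  constructor <;> intro h <;> linarith

lemma finrank_affineFunctions [FiniteDimensional ℝ E] :
    Module.finrank ℝ (Module.Dual ℝ E × ℝ) = Module.finrank ℝ E + 1 := by
  rw [Module.finrank_prod, Subspace.dual_finrank_eq, Module.finrank_self]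

variable [FiniteDimensional ℝ E] {V : Finset E} {d k : ℕ}

lemma setOf_isKFace_eq_image (hV : V.Nonempty) (hd : dimSet (convexHull ℝ (V : Set E)) = d)
    (hk : k ≤ d) :
    {G | IsKFace (convexHull ℝ (V : Set E)) k G} =
      (fun T : Finset E => convexHull ℝ (T : Set E)) '' facesAbove (affineEval E) V ∅ (d - k) := by
  have hVd := corank_affineEval_add_dimSet hV
  ext G
  simp only [Set.mem_ofPred_eq, Set.mem_image, Finset.mem_coe, mem_facesAbove]
  constructor
  · rintro ⟨hG, hne, hdim⟩
    obtain ⟨T, hT, rfl⟩ := exists_isVFace_of_isFace hG hne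
    have hTne : T.Nonempty := by simpa using hne
    have := corank_affineEval_add_dimSet hTne
    exact ⟨T, ⟨hT, by simp, by omega⟩, rfl⟩
  · rintro ⟨T, ⟨hT, -, hc⟩, rfl⟩
    have hTne : T.Nonempty := by
      rw [Finset.nonempty_iff_ne_empty]
      rintro rfl
      rw [corank_empty, finrank_affineFunctions] at hc
      omega
    have := corank_affineEval_add_dimSet hTne
    exact ⟨hT.isFace_convexHull, by simpa using hTne, by omega⟩

lemma fVec_convexHull (hV : V.Nonempty) (hd : dimSet (convexHull ℝ (V : Set E)) = d)
    (hk : k ≤ d) :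
    fVec (convexHull ℝ (V : Set E)) k = (facesAbove (affineEval E) V ∅ (d - k)).card := by
  classical
  rw [fVec, setOf_isKFace_eq_image hV hd hk, Set.InjOn.ncard_image, Set.ncard_coe_finset]
  intro T hT T' hT' h
  rw [Finset.mem_coe, mem_facesAbove] at hT hT'
  rw [← hT.1.filter_mem_convexHull, ← hT'.1.filter_mem_convexHull]
  simp only [h]

lemma isSimplicialPolytope_convexHull_iff (hV : V.Nonempty)
    (hd : dimSet (convexHull ℝ (V : Set E)) = d) (hd1 : 1 ≤ d) :
    IsSimplicialPolytope (convexHull ℝ (V : Set E)) d ↔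
      ∀ F ∈ facesAbove (affineEval E) V ∅ 1,
        (facesAbove (affineEval E) F ∅ (d - 1)).card = d := by
  have himg := setOf_isKFace_eq_image hV hd (Nat.sub_le d 1)
  rw [Nat.sub_sub_self hd1] at himg
  have hcard : ∀ F ∈ facesAbove (affineEval E) V ∅ 1, fVec (convexHull ℝ (F : Set E)) 0 =
      (facesAbove (affineEval E) F ∅ (d - 1)).card := by
    intro F hF
    have hK : IsKFace (convexHull ℝ (V : Set E)) (d - 1) (convexHull ℝ (F : Set E)) :=
      himg.ge ⟨F, hF, rfl⟩
    exact fVec_convexHull (by simpa using hK.2.1) hK.2.2 (Nat.zero_le _)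
  constructor
  · intro h F hF
    rw [← hcard F hF]
    exact h _ (himg.ge ⟨F, hF, rfl⟩)
  · intro h G hG
    obtain ⟨F, hF, rfl⟩ := himg.le hG
    exact (hcard F hF).trans (h F hF)

end polytope

end VFace

/-- For a `d`-polytope `P` and `0 ≤ k ≤ d-1`, equality
`f_k(P) = ρ(d,d-k-1) ⬝ f_{d-1}(P)` holds iff `k = d-1`, or `k = d-2` and `P` is
simplicial. -/
theorem face_count_facets_equality_iff {N : ℕ} (d k : ℕ) (P : Set (Euc N))
    (hP : IsPolytope P) (hd : dimSet P = d) (hk : k + 1 ≤ d) :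
    (fVec P k : ℚ) = rho d (d - k - 1) * (fVec P (d - 1) : ℚ) ↔
      k = d - 1 ∨ (k = d - 2 ∧ IsSimplicialPolytope P d) := by
  obtain ⟨V, rfl⟩ := hP
  have hV : V.Nonempty := by
    rw [Finset.nonempty_iff_ne_empty]
    rintro rfl
    rw [dimSet, affineSpan_convexHull, direction_affineSpan, Finset.coe_empty,
      vectorSpan_empty, finrank_bot] at hd
    omega
  have hc₀ : ∀ v ∈ V, 0 < VFace.affineEval (Euc N) (0, 1) v := fun v _ => by simp
  have hrank : Module.finrank ℝ (Module.Dual ℝ (Euc N) × ℝ) =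
      VFace.corank (VFace.affineEval (Euc N)) V + d + 1 := by
    rw [VFace.finrank_affineFunctions, ← VFace.corank_affineEval_add_dimSet hV, hd]
  rw [VFace.fVec_convexHull hV hd (by omega), VFace.fVec_convexHull hV hd (Nat.sub_le d 1),
    Nat.sub_sub_self (by omega : 1 ≤ d)]
  obtain ⟨m, hm⟩ : ∃ m, d = k + 1 + m := ⟨d - (k + 1), by omega⟩
  rw [show d - k = m + 1 by omega, Nat.add_sub_cancel]
  rcases Nat.lt_or_ge m 2 with hm2 | hm2
  · obtain rfl | rfl : m = 0 ∨ m = 1 := by omega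
    · simp [rho, show k = d - 1 by omega]
    · have hsimp := VFace.isSimplicialPolytope_convexHull_iff hV hd (by omega)
      rw [← VFace.two_mul_card_ridges_eq_iff hc₀ (by omega) hrank] at hsimp
      have hrho : rho d 1 = d / 2 := by
        rw [rho, Nat.choose_one_right, Nat.choose_one_right]
        have : (d + 1) / 2 + d / 2 = d := by omega
        rw [← Nat.cast_add, this]
      rw [← Nat.cast_inj (R := ℚ), Nat.cast_mul, Nat.cast_mul, Nat.cast_ofNat] at hsimp
      rw [hrho, hsimp]
      constructor
      · exact fun h => .inr ⟨by omega, by rw [h]; ring⟩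
      · rintro (h | ⟨-, h⟩)
        · omega
        · linarith
  · have hlt := VFace.card_facets_mul_lt hc₀ hrank hm2 (by omega)
    have hlt' : rho d m * ((VFace.facesAbove (VFace.affineEval (Euc N)) V ∅ 1).card : ℚ) <
        ((VFace.facesAbove (VFace.affineEval (Euc N)) V ∅ (m + 1)).card : ℚ) := by
      have : ((((d + 1) / 2).choose m + (d / 2).choose m) *
          (VFace.facesAbove (VFace.affineEval (Euc N)) V ∅ 1).card : ℚ) <
          2 * (VFace.facesAbove (VFace.affineEval (Euc N)) V ∅ (m + 1)).card := by
        exact_mod_cast hlt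
      rw [rho]
      linarith
    refine iff_of_false hlt'.ne' ?_
    rintro (h | ⟨h, -⟩) <;> omega
end
end

section
/- Let d ≥ 1, let Q be a (d−1)-polytope, and let 0 ≤ k ≤ d−2. Then φ_k(Q) ≥ ρ(d, d−k−1). -/
noncomputable section

open MeasureTheory in
/-- `a` is the solid angle of the (full-dimensional) polytope `Q` at its face `G`:
for any point `z` in the relative interior of `G` and any sufficiently small ball `B`
around `z`, `a = λ(B ∩ Q)/λ(B)`. -/
def IsSolidAngle {n : ℕ} (Q G : Set (Euc n)) (a : ℝ) : Prop :=
  ∀ z ∈ intrinsicInterior ℝ G, ∀ᶠ r in nhdsWithin (0 : ℝ) (Set.Ioi 0),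
    (volume (Metric.ball z r ∩ Q)).toReal / (volume (Metric.ball z r)).toReal = a

/-- `s = φ_k(Q)`, the sum of the solid angles of `Q` at its `k`-dimensional faces. -/
def IsSolidAngleSum {n : ℕ} (Q : Set (Euc n)) (k : ℕ) (s : ℝ) : Prop :=
  ∃ (faces : Finset (Set (Euc n))) (a : Set (Euc n) → ℝ),
    (faces : Set (Set (Euc n))) = {G | IsKFace Q k G} ∧
    (∀ G ∈ faces, IsSolidAngle Q G (a G)) ∧
    s = ∑ G ∈ faces, a G

/-- `S` indexes the generators, among the vectors `a i` for `i ∈ A`, of a face of the convex cone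
they span. -/
def IsConeFace {ι W : Type*} [AddCommGroup W] [Module ℝ W] (a : ι → W) (A S : Finset ι) : Prop :=
  ∃ f : W →ₗ[ℝ] ℝ, (∀ i ∈ A, f (a i) ≤ 0) ∧ ∀ i, i ∈ S ↔ i ∈ A ∧ f (a i) = 0

/-- The dimension of the span of the vectors `a i` for `i ∈ S`. -/
def coneRank {ι W : Type*} [AddCommGroup W] [Module ℝ W] (a : ι → W) (S : Finset ι) : ℕ :=
  Module.finrank ℝ (Submodule.span ℝ (a '' S))

section Cone

variable {ι W : Type*} [AddCommGroup W] [Module ℝ W] {a : ι → W} {A S T : Finset ι}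

theorem IsConeFace.refl (a : ι → W) (A : Finset ι) : IsConeFace a A A :=
  ⟨0, by simp, by simp⟩

theorem IsConeFace.subset (h : IsConeFace a A S) : S ⊆ A := by
  obtain ⟨f, -, hS⟩ := h
  exact fun i hi => ((hS i).1 hi).1

theorem IsConeFace.of_subset (h : IsConeFace a A S) (hST : S ⊆ T) (hTA : T ⊆ A) :
    IsConeFace a T S := by
  obtain ⟨f, hf, hS⟩ := h
  exact ⟨f, fun i hi => hf i (hTA hi), fun i =>
    ⟨fun hi => ⟨hST hi, ((hS i).1 hi).2⟩, fun hi => (hS i).2 ⟨hTA hi.1, hi.2⟩⟩⟩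

theorem IsConeFace.trans (h : IsConeFace a A S) (h' : IsConeFace a S T) : IsConeFace a A T := by
  obtain ⟨f, hf, hS⟩ := h
  obtain ⟨g, hg, hT⟩ := h'
  have key : ∃ M : ℝ, ∀ i ∈ A, i ∉ S → M * f (a i) + g (a i) < 0 := by
    obtain ⟨M, hM⟩ := (A.image fun i => (g (a i) + 1) / (-f (a i))).bddAbove
    refine ⟨M, fun i hi hiS => ?_⟩
    have h1 : f (a i) < 0 := lt_of_le_of_ne (hf i hi) fun h0 => hiS ((hS i).2 ⟨hi, h0⟩)
    have h2 : (g (a i) + 1) / (-f (a i)) ≤ M :=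
      hM (Finset.mem_coe.2 (Finset.mem_image_of_mem _ hi))
    rw [div_le_iff₀ (by linarith)] at h2
    linarith
  obtain ⟨M, hM⟩ := key
  refine ⟨M • f + g, fun i hi => ?_, fun i => ?_⟩
  · simp only [LinearMap.add_apply, LinearMap.smul_apply, smul_eq_mul]
    by_cases hiS : i ∈ S
    · rw [((hS i).1 hiS).2]
      linarith [hg i hiS]
    · exact (hM i hi hiS).le
  · simp only [LinearMap.add_apply, LinearMap.smul_apply, smul_eq_mul]
    rw [hT i]
    constructor
    · rintro ⟨h1, h2⟩
      exact ⟨((hS i).1 h1).1, by rw [((hS i).1 h1).2, h2]; ring⟩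
    · rintro ⟨h1, h2⟩
      have hiS : i ∈ S := by
        by_contra hiS
        exact absurd h2 (hM i h1 hiS).ne
      rw [((hS i).1 hiS).2] at h2
      exact ⟨hiS, by linarith⟩

theorem coneRank_mono [FiniteDimensional ℝ W] (h : S ⊆ T) : coneRank a S ≤ coneRank a T :=
  Submodule.finrank_mono (Submodule.span_mono (Set.image_mono (by exact_mod_cast h)))

theorem IsConeFace.coneRank_lt [FiniteDimensional ℝ W] (h : IsConeFace a A S) (hne : S ≠ A) :
    coneRank a S < coneRank a A := by
  have hsub := h.subset
  obtain ⟨f, hf, hS⟩ := h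
  refine Submodule.finrank_lt_finrank_of_lt (lt_of_le_of_ne
    (Submodule.span_mono (Set.image_mono (by exact_mod_cast hsub))) fun heq => hne ?_)
  refine Finset.Subset.antisymm hsub fun i hi => (hS i).2 ⟨hi, ?_⟩
  have h1 : Submodule.span ℝ (a '' S) ≤ LinearMap.ker f := by
    rw [Submodule.span_le]
    rintro _ ⟨j, hj, rfl⟩
    exact ((hS j).1 hj).2
  exact h1 (heq ▸ Submodule.subset_span ⟨i, hi, rfl⟩)

/-- A face of codimension at least two is the intersection of two strictly larger faces. -/
theorem IsConeFace.exists_inter_eq [DecidableEq ι] [FiniteDimensional ℝ W]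
    (h : IsConeFace a A S) (hrank : coneRank a S + 2 ≤ coneRank a A) :
    ∃ X Y, IsConeFace a A X ∧ IsConeFace a A Y ∧ S ⊂ X ∧ S ⊂ Y ∧ X ∩ Y = S := by
  have hsub := h.subset
  obtain ⟨i₀, hi₀, hi₀S⟩ : ∃ i₀ ∈ A, i₀ ∉ S := by
    by_contra! hcon
    have := coneRank_mono (a := a) (show A ⊆ S from hcon)
    omega
  obtain ⟨f, hf, hS⟩ := h
  set P := Submodule.span ℝ (a '' S) ⊔ Submodule.span ℝ {a i₀} with hP
  have hPrank : Module.finrank ℝ P < coneRank a A := by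
    have h1 := Submodule.finrank_add_le_finrank_add_finrank
      (Submodule.span ℝ (a '' S)) (Submodule.span ℝ {a i₀})
    have h2 : Module.finrank ℝ (Submodule.span ℝ {a i₀}) ≤ 1 := by
      simpa using finrank_span_le_card (R := ℝ) {a i₀}
    change _ ≤ coneRank a S + _ at h1
    rw [hP]
    omega
  obtain ⟨i₁, hi₁, hi₁P⟩ : ∃ i₁ ∈ A, a i₁ ∉ P := by
    by_contra! hcon
    have : Submodule.span ℝ (a '' A) ≤ P := by
      rw [Submodule.span_le]
      rintro _ ⟨j, hj, rfl⟩
      exact hcon j hj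
    exact absurd (Submodule.finrank_mono this) (not_le.2 hPrank)
  obtain ⟨g, hg1, hgP⟩ := Submodule.exists_le_ker_of_notMem hi₁P
  have hgS : ∀ i ∈ S, g (a i) = 0 := fun i hi =>
    hgP (Submodule.mem_sup_left (Submodule.subset_span ⟨i, hi, rfl⟩))
  have hg0 : g (a i₀) = 0 := hgP (Submodule.mem_sup_right (Submodule.mem_span_singleton_self _))
  have hi₁S : i₁ ∉ S := fun hi => hg1 (hgS _ hi)
  have hneg : ∀ i ∈ A, i ∉ S → f (a i) < 0 := fun i hi hiS =>
    lt_of_le_of_ne (hf i hi) fun h0 => hiS ((hS i).2 ⟨hi, h0⟩)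
  set r : ι → ℝ := fun i => g (a i) / (-f (a i)) with hr
  have hgr : ∀ i ∈ A, i ∉ S → g (a i) = - r i * f (a i) := fun i hi hiS => by
    have := (hneg i hi hiS).ne
    simp only [hr]; field_simp
  obtain ⟨x, hx, hxmax⟩ := (A \ S).exists_max_image r ⟨i₀, by simp [hi₀, hi₀S]⟩
  obtain ⟨y, hy, hymin⟩ := (A \ S).exists_min_image r ⟨i₀, by simp [hi₀, hi₀S]⟩
  rw [Finset.mem_sdiff] at hx hy
  have hlt : r y < r x := by
    by_contra! hle
    have e0 : r i₀ = 0 := by simp [hr, hg0]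
    have e1 : r i₁ ≠ 0 := div_ne_zero hg1 (neg_ne_zero.2 (hneg _ hi₁ hi₁S).ne)
    have m0 : i₀ ∈ A \ S := by simp [hi₀, hi₀S]
    have m1 : i₁ ∈ A \ S := by simp [hi₁, hi₁S]
    refine e1 (le_antisymm ?_ ?_)
    · linarith [hxmax _ m1, hymin _ m0]
    · linarith [hxmax _ m0, hymin _ m1]
  have hX : ∀ c : ℝ, ∀ i ∈ S, g (a i) + c * f (a i) = 0 := fun c i hi => by
    rw [hgS i hi, ((hS i).1 hi).2]; ring
  have hval : ∀ c : ℝ, ∀ i ∈ A, i ∉ S → g (a i) + c * f (a i) = (c - r i) * f (a i) :=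
    fun c i hi hiS => by rw [hgr i hi hiS]; ring
  refine ⟨A.filter fun i => g (a i) + r x * f (a i) = 0,
    A.filter fun i => g (a i) + r y * f (a i) = 0,
    ⟨g + r x • f, fun i hi => ?_, fun i => by simp⟩,
    ⟨-(g + r y • f), fun i hi => ?_, fun i => ?_⟩, ?_, ?_, ?_⟩
  · simp only [LinearMap.add_apply, LinearMap.smul_apply, smul_eq_mul]
    by_cases hiS : i ∈ S
    · exact (hX _ i hiS).le
    · rw [hval _ i hi hiS]
      exact mul_nonpos_of_nonneg_of_nonpos
        (sub_nonneg.2 (hxmax i (Finset.mem_sdiff.2 ⟨hi, hiS⟩))) (hf i hi)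
  · simp only [LinearMap.neg_apply, LinearMap.add_apply, LinearMap.smul_apply, smul_eq_mul,
      Left.neg_nonpos_iff]
    by_cases hiS : i ∈ S
    · exact (hX _ i hiS).ge
    · rw [hval _ i hi hiS]
      exact mul_nonneg_of_nonpos_of_nonpos
        (sub_nonpos.2 (hymin i (Finset.mem_sdiff.2 ⟨hi, hiS⟩))) (hf i hi)
  · simp only [Finset.mem_filter, LinearMap.neg_apply, LinearMap.add_apply, LinearMap.smul_apply,
      smul_eq_mul, neg_eq_zero]
  · refine Finset.ssubset_iff_subset_ne.2
      ⟨fun i hi => Finset.mem_filter.2 ⟨hsub hi, hX _ i hi⟩, fun heq => hx.2 ?_⟩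
    rw [heq, Finset.mem_filter]
    exact ⟨hx.1, by rw [hval _ x hx.1 hx.2]; ring⟩
  · refine Finset.ssubset_iff_subset_ne.2
      ⟨fun i hi => Finset.mem_filter.2 ⟨hsub hi, hX _ i hi⟩, fun heq => hy.2 ?_⟩
    rw [heq, Finset.mem_filter]
    exact ⟨hy.1, by rw [hval _ y hy.1 hy.2]; ring⟩
  · ext i
    simp only [Finset.mem_inter, Finset.mem_filter]
    refine ⟨fun ⟨⟨hi, h1⟩, _, h2⟩ => ?_, fun hi => ⟨⟨hsub hi, hX _ i hi⟩, hsub hi, hX _ i hi⟩⟩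
    by_contra hiS
    have h3 : (r x - r y) * f (a i) = 0 := by linarith
    rcases mul_eq_zero.1 h3 with h4 | h4
    · linarith
    · exact (hneg i hi hiS).ne h4

theorem IsConeFace.exists_cover [FiniteDimensional ℝ W] (h : IsConeFace a A S) (hne : S ≠ A) :
    ∃ G, IsConeFace a A G ∧ S ⊆ G ∧ coneRank a G = coneRank a S + 1 := by
  classical
  induction hn : A.card using Nat.strong_induction_on generalizing A with
  | _ n ih =>
    have hlt := h.coneRank_lt hne
    rcases Nat.lt_or_ge (coneRank a S + 1) (coneRank a A) with h2 | h2
    · obtain ⟨X, Y, hX, hY, hSX, hSY, hXY⟩ := h.exists_inter_eq h2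
      have hXA : X ⊂ A := by
        refine Finset.ssubset_iff_subset_ne.2 ⟨hX.subset, fun heq => hSY.ne ?_⟩
        rw [← hXY, heq, Finset.inter_eq_right.2 hY.subset]
      have hSX' : IsConeFace a X S := h.of_subset hSX.subset hX.subset
      obtain ⟨G, hG, hSG, hr⟩ := ih X.card (hn ▸ Finset.card_lt_card hXA) hSX' hSX.ne rfl
      exact ⟨G, hX.trans hG, hSG, hr⟩
    · exact ⟨A, .refl a A, h.subset, by omega⟩

theorem IsConeFace.exists_facet [FiniteDimensional ℝ W] (h : IsConeFace a A S)
    (hT : IsConeFace a A T) (hTS : ¬ T ⊆ S) :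
    ∃ F, IsConeFace a A F ∧ S ⊆ F ∧ ¬ T ⊆ F ∧ coneRank a F + 1 = coneRank a A := by
  classical
  obtain ⟨F, hF, hmax⟩ := (A.powerset.filter fun F => IsConeFace a A F ∧ S ⊆ F ∧ ¬ T ⊆ F)
    |>.exists_max_image Finset.card
      ⟨S, by simp only [Finset.mem_filter, Finset.mem_powerset]
             exact ⟨h.subset, h, subset_rfl, hTS⟩⟩
  simp only [Finset.mem_filter, Finset.mem_powerset] at hF hmax
  obtain ⟨-, hF, hSF, hTF⟩ := hF
  refine ⟨F, hF, hSF, hTF, ?_⟩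
  have hlt := hF.coneRank_lt fun heq => hTF (heq ▸ hT.subset)
  by_contra hcon
  obtain ⟨X, Y, hX, hY, hFX, hFY, hXY⟩ := hF.exists_inter_eq (by omega)
  have aux : ∀ Z, IsConeFace a A Z → F ⊂ Z → T ⊆ Z := fun Z hZ hFZ => by
    by_contra hTZ
    exact absurd (hmax Z ⟨hZ.subset, hZ, hSF.trans hFZ.subset, hTZ⟩)
      (not_le.2 (Finset.card_lt_card hFZ))
  exact hTF (hXY ▸ Finset.subset_inter (aux X hX hFX) (aux Y hY hFY))

open Classical in
/-- The number of faces of given codimension containing a given face is at least the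
corresponding number for a simplicial cone. -/
theorem IsConeFace.choose_le_card [FiniteDimensional ℝ W] (h : IsConeFace a A S) {k : ℕ}
    (hk : k ≤ coneRank a A) :
    (coneRank a A - coneRank a S).choose (coneRank a A - k) ≤
      (A.powerset.filter fun G => IsConeFace a A G ∧ S ⊆ G ∧ coneRank a G = k).card := by
  induction hn : coneRank a A - coneRank a S generalizing A S with
  | zero =>
    rcases hk.eq_or_lt with rfl | hk
    · simp only [tsub_self, Nat.choose_self]
      exact Finset.card_pos.2 ⟨A, by simp [IsConeFace.refl, h.subset]⟩
    · rw [Nat.choose_eq_zero_of_lt (by omega)]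
      exact Nat.zero_le _
  | succ n ih =>
    rcases hk.eq_or_lt with rfl | hk
    · simp only [tsub_self, Nat.choose_zero_right]
      exact Finset.card_pos.2 ⟨A, by simp [IsConeFace.refl, h.subset]⟩
    obtain ⟨T, hT, hST, hTr⟩ := h.exists_cover (by rintro rfl; omega)
    obtain ⟨F, hF, hSF, hTF, hFr⟩ := h.exists_facet hT fun hTS => by
      have := coneRank_mono (a := a) hTS
      omega
    have hFS : IsConeFace a F S := h.of_subset hSF hF.subset
    have h1 := ih hFS (by omega) (by omega)
    have h2 := ih hT hk.le (by omega)
    obtain ⟨j, hj⟩ : ∃ j, coneRank a A - k = j + 1 := ⟨coneRank a A - k - 1, by omega⟩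
    rw [show coneRank a F - k = j by omega] at h1
    rw [hj] at h2
    rw [hj, Nat.choose_succ_succ]
    refine (add_le_add h1 h2).trans ?_
    rw [← Finset.card_union_of_disjoint]
    · refine Finset.card_le_card (Finset.union_subset ?_ ?_)
      · intro G
        simp only [Finset.mem_filter, Finset.mem_powerset]
        rintro ⟨-, hG, hSG, hr⟩
        exact ⟨(hF.trans hG).subset, hF.trans hG, hSG, hr⟩
      · intro G
        simp only [Finset.mem_filter, Finset.mem_powerset]
        rintro ⟨hGA, hG, hTG, hr⟩
        exact ⟨hGA, hG, hST.trans hTG, hr⟩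
    · rw [Finset.disjoint_left]
      intro G
      simp only [Finset.mem_filter, Finset.mem_powerset]
      rintro ⟨hGF, -⟩ ⟨-, -, hTG, -⟩
      exact hTF (hTG.trans hGF)

end Cone

theorem choose_add_choose_le_of_gap (j b t c : ℕ) :
    (b + t).choose j + (b + t + c).choose j ≤ b.choose j + (b + 2 * t + c).choose j := by
  have step : ∀ x c : ℕ, (x + 1).choose j + (x + c).choose j ≤
      x.choose j + (x + c + 1).choose j := by
    intro x c
    cases j with
    | zero => simp
    | succ j =>
      have := Nat.choose_le_choose j (Nat.le_add_right x c)
      rw [Nat.choose_succ_succ' x, Nat.choose_succ_succ' (x + c)]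
      omega
  induction t generalizing b c with
  | zero => simp
  | succ t ih =>
    have h1 := ih (b + 1) c
    have h2 := step b (2 * t + 1 + c)
    rw [show b + 1 + t = b + (t + 1) by ring, show b + 1 + 2 * t + c = b + (2 * t + 1 + c) by ring]
      at h1
    rw [show b + (2 * t + 1 + c) + 1 = b + 2 * (t + 1) + c by ring] at h2
    omega

theorem choose_half_add_choose_half_le {d x y j : ℕ} (h : d ≤ x + y) :
    ((d + 1) / 2).choose j + (d / 2).choose j ≤ x.choose j + y.choose j := by
  wlog hxy : x ≤ y generalizing x y
  · rw [add_comm (x.choose j)]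
    exact this (by omega) (by omega)
  rcases Nat.lt_or_ge (d / 2) x with hx | hx
  · rw [add_comm]
    exact add_le_add (Nat.choose_le_choose _ (by omega)) (Nat.choose_le_choose _ (by omega))
  · have h1 := choose_add_choose_le_of_gap j x (d / 2 - x) (d % 2)
    have h2 : (x + 2 * (d / 2 - x) + d % 2).choose j ≤ y.choose j :=
      Nat.choose_le_choose _ (by omega)
    rw [show x + (d / 2 - x) = d / 2 by omega,
      show d / 2 + d % 2 = (d + 1) / 2 by omega] at h1
    omega

section Polytope

variable {E : Type*} [NormedAddCommGroup E] [InnerProductSpace ℝ E]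

/-- A point of a polytope that maximizes a functional is a convex combination of the maximizing
vertices. -/
theorem mem_convexHull_of_isMaxOn {V S : Finset E} {x : E} (hx : x ∈ convexHull ℝ (V : Set E))
    (f : E →ₗ[ℝ] ℝ) (hf : ∀ v ∈ V, f v ≤ f x) (hSV : S ⊆ V) (hS : ∀ v ∈ V, f v = f x → v ∈ S) :
    x ∈ convexHull ℝ (S : Set E) := by
  obtain ⟨w, hw0, hw1, hwx⟩ := Finset.mem_convexHull'.1 hx
  have hsum : ∑ v ∈ V, w v * (f x - f v) = 0 := by
    have h1 : f x = ∑ v ∈ V, w v * f v := by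
      conv_lhs => rw [← hwx]
      simp [map_sum]
    simp only [mul_sub, Finset.sum_sub_distrib, ← Finset.sum_mul, hw1, ← h1]
    ring
  have hzero := (Finset.sum_eq_zero_iff_of_nonneg fun v hv =>
    mul_nonneg (hw0 v hv) (sub_nonneg.2 (hf v hv))).1 hsum
  have hw : ∀ v ∈ V, v ∉ S → w v = 0 := fun v hv hvS => by
    rcases mul_eq_zero.1 (hzero v hv) with h | h
    · exact h
    · exact absurd (hS v hv (by linarith)) hvS
  refine Finset.mem_convexHull'.2 ⟨w, fun v hv => hw0 v (hSV hv), ?_, ?_⟩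
  · rw [← hw1]
    exact Finset.sum_subset hSV hw
  · rw [← hwx]
    exact Finset.sum_subset hSV fun v hv hvS => by rw [hw v hv hvS, zero_smul]

theorem IsConeFace.mem_convexHull {V S : Finset E} {p : E}
    (h : IsConeFace (fun v => v - p) V S) (hp : p ∈ convexHull ℝ (V : Set E)) :
    p ∈ convexHull ℝ (S : Set E) := by
  have hsub := h.subset
  obtain ⟨f, hf, hS⟩ := h
  refine mem_convexHull_of_isMaxOn hp f (fun v hv => ?_) hsub fun v hv hvp => ?_
  · simpa using hf v hv
  · exact (hS v).2 ⟨hv, by simp [hvp]⟩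

theorem IsConeFace.exists_convexHull_eq {V S : Finset E} {p : E}
    (h : IsConeFace (fun v => v - p) V S) :
    ∃ f : E →ₗ[ℝ] ℝ, (∀ x ∈ convexHull ℝ (V : Set E), f x ≤ f p) ∧
      convexHull ℝ (S : Set E) = {x ∈ convexHull ℝ (V : Set E) | f x = f p} ∧
      ∀ v, v ∈ S ↔ v ∈ V ∧ f v = f p := by
  have hsub := h.subset
  obtain ⟨f, hf, hS⟩ := h
  have hS' : ∀ v, v ∈ S ↔ v ∈ V ∧ f v = f p := by simpa [sub_eq_zero] using hS
  have hle : convexHull ℝ (V : Set E) ⊆ {x | f x ≤ f p} :=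
    convexHull_min (fun v hv => by simpa using hf v hv) (convex_halfSpace_le f.isLinear _)
  refine ⟨f, hle, ?_, hS'⟩
  apply Set.Subset.antisymm
  · refine fun x hx => ⟨convexHull_mono (by exact_mod_cast hsub) hx, ?_⟩
    exact convexHull_min (t := {x | f x = f p}) (fun v hv => ((hS' v).1 hv).2)
      (convex_hyperplane f.isLinear _) hx
  · rintro x ⟨hx, hxp⟩
    refine mem_convexHull_of_isMaxOn hx f (fun v hv => ?_) hsub fun v hv hvx => ?_
    · rw [hxp]
      exact hle (subset_convexHull ℝ _ hv)
    · exact (hS' v).2 ⟨hv, hvx.trans hxp⟩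

theorem dimSet_convexHull_eq_coneRank {S : Finset E} {p : E}
    (hp : p ∈ convexHull ℝ (S : Set E)) :
    dimSet (convexHull ℝ (S : Set E)) = coneRank (fun v => v - p) S := by
  unfold dimSet coneRank
  rw [direction_affineSpan, vectorSpan_eq_span_vsub_set_right ℝ hp]
  suffices h : Submodule.span ℝ ((fun x => x -ᵥ p) '' convexHull ℝ (S : Set E)) =
      Submodule.span ℝ ((fun v => v - p) '' (S : Set E)) by rw [h]
  apply le_antisymm
  · rw [Submodule.span_le]
    rintro _ ⟨x, hx, rfl⟩
    refine convexHull_min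
      (t := (fun x => x - p) ⁻¹' (Submodule.span ℝ ((fun v => v - p) '' (S : Set E)) : Set E))
      (fun v hv => Submodule.subset_span ⟨v, hv, rfl⟩) ?_ hx
    intro x hx y hy a b _ _ hab
    have : a • x + b • y - p = a • (x - p) + b • (y - p) := by
      rw [smul_sub, smul_sub, sub_add_sub_comm, ← add_smul, hab, one_smul]
    simp only [Set.mem_preimage, this, SetLike.mem_coe] at hx hy ⊢
    exact add_mem (Submodule.smul_mem _ _ hx) (Submodule.smul_mem _ _ hy)
  · exact Submodule.span_mono (Set.image_mono (subset_convexHull ℝ _))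

theorem IsConeFace.isKFace [FiniteDimensional ℝ E] {V S : Finset E} {p : E}
    (h : IsConeFace (fun v => v - p) V S) (hp : p ∈ convexHull ℝ (V : Set E)) :
    IsKFace (convexHull ℝ (V : Set E)) (coneRank (fun v => v - p) S)
      (convexHull ℝ (S : Set E)) := by
  have hpS := h.mem_convexHull hp
  refine ⟨?_, ⟨p, hpS⟩, dimSet_convexHull_eq_coneRank hpS⟩
  obtain ⟨f, hf, hG, -⟩ := h.exists_convexHull_eq
  by_cases hf0 : f = 0
  · left
    rw [hG]
    simp [hf0]
  · refine Or.inr (Or.inr ⟨LinearMap.toContinuousLinearMap f, ?_, f p, hf, hG⟩)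
    intro h0
    exact hf0 (LinearMap.toContinuousLinearMap.map_eq_zero_iff.1 h0)

/-- A point `p` of a polytope lies in the relative interior of a face. -/
theorem exists_isConeFace_eventually_mem [FiniteDimensional ℝ E] {V : Finset E} {p : E}
    (hp : p ∈ convexHull ℝ (V : Set E)) :
    ∃ S, IsConeFace (fun v => v - p) V S ∧
      ∀ w ∈ Submodule.span ℝ ((fun v => v - p) '' (S : Set E)),
        ∀ᶠ δ in nhds (0 : ℝ), p + δ • w ∈ convexHull ℝ (V : Set E) := by
  classical
  obtain ⟨S, hS, hmin⟩ := (V.powerset.filter fun S => IsConeFace (fun v => v - p) V S)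
    |>.exists_min_image Finset.card ⟨V, by simp [IsConeFace.refl]⟩
  simp only [Finset.mem_filter, Finset.mem_powerset] at hS hmin
  replace hS := hS.2
  have hpS := hS.mem_convexHull hp
  refine ⟨S, hS, ?_⟩
  set U := Submodule.span ℝ ((fun v => v - p) '' (S : Set E)) with hU
  set K : Set U := {w | p + (w : E) ∈ convexHull ℝ (S : Set E)} with hK
  have hKconv : Convex ℝ K := by
    intro x hx y hy a b ha hb hab
    have h1 := convex_convexHull ℝ (S : Set E) hx hy ha hb hab
    have h2 : p + ((a • x + b • y : U) : E) = a • (p + (x : E)) + b • (p + (y : E)) := by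
      rw [smul_add, smul_add, add_add_add_comm, ← add_smul, hab, one_smul]
      rfl
    simpa only [hK, Set.mem_ofPred_eq, h2] using h1
  have hzeroK : (0 : U) ∈ K := by simpa [hK] using hpS
  have hgen : ((↑) ⁻¹' ((fun v => v - p) '' (S : Set E)) : Set U) ⊆ K := by
    rintro w ⟨v, hv, hvw⟩
    simp only [hK, Set.mem_ofPred_eq, ← hvw, add_sub_cancel]
    exact subset_convexHull ℝ _ hv
  have hint : (interior K).Nonempty := by
    rw [hKconv.interior_nonempty_iff_affineSpan_eq_top,
      AffineSubspace.affineSpan_eq_top_iff_vectorSpan_eq_top_of_nonempty _ _ _ ⟨0, hzeroK⟩,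
      vectorSpan_eq_span_vsub_set_right ℝ hzeroK, eq_top_iff, ← Submodule.span_span_coe_preimage]
    refine Submodule.span_mono fun w hw => ⟨w, hgen hw, by simp⟩
  have hmem : (0 : U) ∈ interior K := by
    by_contra h0
    obtain ⟨f, hf0, hf⟩ := geometric_hahn_banach_of_nonempty_interior_point hKconv h0 hint
    obtain ⟨g, hg⟩ := LinearMap.exists_extend (f : U →ₗ[ℝ] ℝ)
    have hgU : ∀ w : U, g w = f w := fun w => LinearMap.congr_fun hg w
    have hvU : ∀ v ∈ S, v - p ∈ U := fun v hv => Submodule.subset_span ⟨v, hv, rfl⟩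
    have hface : IsConeFace (fun v => v - p) S (S.filter fun v => g (v - p) = 0) := by
      refine ⟨g, fun v hv => ?_, by simp⟩
      have := hf ⟨v - p, hvU v hv⟩ (hgen ⟨v, hv, rfl⟩)
      rw [map_zero] at this
      exact (hgU ⟨v - p, hvU v hv⟩).trans_le this
    have heq : (S.filter fun v => g (v - p) = 0) = S :=
      Finset.eq_of_subset_of_card_le hface.subset
        (hmin _ ⟨(hS.trans hface).subset, hS.trans hface⟩)
    have hle : U ≤ LinearMap.ker g := by
      rw [hU, Submodule.span_le]
      rintro _ ⟨v, hv, rfl⟩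
      rw [SetLike.mem_coe, LinearMap.mem_ker]
      exact (Finset.filter_eq_self.1 heq) v hv
    apply hf0
    ext w
    rw [← hgU w]
    exact hle w.2
  intro w hw
  have hcont : Continuous fun δ : ℝ => δ • (⟨w, hw⟩ : U) := by fun_prop
  have htend : ∀ᶠ δ in nhds (0 : ℝ), δ • (⟨w, hw⟩ : U) ∈ K :=
    hcont.continuousAt.eventually_mem (by simpa using mem_interior_iff_mem_nhds.1 hmem)
  filter_upwards [htend] with δ hδ
  exact convexHull_mono (by exact_mod_cast hS.subset) hδ

/-- A longest chord of a convex body in a given direction: one cannot move both endpoints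
in the same way, nor move the endpoints apart. -/
theorem exists_longest_chord {Q : Set E} (hQc : IsCompact Q)
    (hint : (interior Q).Nonempty) {u : E} (hu : u ≠ 0) :
    ∃ p ∈ Q, ∃ t > (0 : ℝ), p + t • u ∈ Q ∧
      (∀ w, (∀ᶠ δ in nhds (0 : ℝ), p + δ • w ∈ Q) →
        (∀ᶠ δ in nhds (0 : ℝ), p + t • u + δ • w ∈ Q) → w = 0) ∧
      ∀ w w', (∀ᶠ δ in nhds (0 : ℝ), p + δ • w ∈ Q) →
        (∀ᶠ δ in nhds (0 : ℝ), p + t • u + δ • w' ∈ Q) → w' - w ≠ u := by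
  obtain ⟨R, hR⟩ := hQc.isBounded.subset_closedBall 0
  set D : Set (E × ℝ) := (Q ×ˢ Set.Icc 0 (2 * R / ‖u‖)) ∩ {x | x.1 + x.2 • u ∈ Q} with hD
  have hDc : IsCompact D := (hQc.prod isCompact_Icc).inter_right
    (hQc.isClosed.preimage (by fun_prop))
  have hDmem : ∀ x ∈ Q, ∀ t : ℝ, 0 ≤ t → x + t • u ∈ Q → (x, t) ∈ D := by
    intro x hx t ht hxt
    refine ⟨⟨hx, ht, ?_⟩, hxt⟩
    rw [le_div_iff₀ (norm_pos_iff.2 hu)]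
    have h1 := hR hx
    have h2 := hR hxt
    rw [mem_closedBall_zero_iff] at h1 h2
    calc t * ‖u‖ = ‖(x + t • u) - x‖ := by
          rw [add_sub_cancel_left, norm_smul, Real.norm_of_nonneg ht]
      _ ≤ 2 * R := by linarith [norm_sub_le (x + t • u) x]
  obtain ⟨x₀, hx₀⟩ := hint
  obtain ⟨s, hs, hsQ⟩ : ∃ s > (0 : ℝ), x₀ + s • u ∈ Q := by
    have hcont : Continuous fun δ : ℝ => x₀ + δ • u := by fun_prop
    have h1 : ∀ᶠ δ in nhds (0 : ℝ), x₀ + δ • u ∈ Q :=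
      hcont.continuousAt.eventually_mem (by simpa using mem_interior_iff_mem_nhds.1 hx₀)
    obtain ⟨s, h2, hs⟩ := ((h1.filter_mono nhdsWithin_le_nhds).and
      (self_mem_nhdsWithin : Set.Ioi (0 : ℝ) ∈ nhdsWithin 0 (Set.Ioi 0))).exists
    exact ⟨s, hs, h2⟩
  have hsD := hDmem x₀ (interior_subset hx₀) s hs.le hsQ
  obtain ⟨⟨y, t⟩, ⟨⟨hyQ, -⟩, hyt⟩, hmax⟩ :=
    hDc.exists_isMaxOn ⟨_, hsD⟩ continuous_snd.continuousOn
  have ht : 0 < t := hs.trans_le (hmax hsD)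
  have hCc : IsCompact (Q ∩ (fun x => x + t • u) ⁻¹' Q) :=
    hQc.inter_right (hQc.isClosed.preimage (by fun_prop))
  obtain ⟨p, hp⟩ := hCc.extremePoints_nonempty ⟨y, hyQ, hyt⟩
  refine ⟨p, hp.1.1, t, ht, hp.1.2, fun w h1 h2 => ?_, fun w w' h1 h2 huw => ?_⟩
  · have hneg : Filter.Tendsto (fun δ : ℝ => -δ) (nhds 0) (nhds 0) := by
      simpa using (continuous_neg (G := ℝ)).tendsto 0
    obtain ⟨δ, ⟨⟨⟨a1, a2⟩, a3⟩, a4⟩, hδ⟩ := (((((h1.and h2).and (hneg.eventually h1)).and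
      (hneg.eventually h2)).filter_mono nhdsWithin_le_nhds).and
      (self_mem_nhdsWithin : Set.Ioi (0 : ℝ) ∈ nhdsWithin 0 (Set.Ioi 0))).exists
    have hseg : p ∈ openSegment ℝ (p + δ • w) (p + (-δ) • w) := by
      refine ⟨1 / 2, 1 / 2, by norm_num, by norm_num, by norm_num, ?_⟩
      module
    have := hp.2 (x₁ := p + δ • w) ⟨a1, by
      simpa only [Set.mem_preimage, add_right_comm] using a2⟩ (x₂ := p + (-δ) • w) ⟨a3, by
      simpa only [Set.mem_preimage, add_right_comm] using a4⟩ hseg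
    exact (smul_eq_zero.1 (add_eq_left.1 this)).resolve_left (ne_of_gt hδ)
  · obtain ⟨δ, ⟨a1, a2⟩, hδ⟩ := (((h1.and h2).filter_mono nhdsWithin_le_nhds).and
      (self_mem_nhdsWithin : Set.Ioi (0 : ℝ) ∈ nhdsWithin 0 (Set.Ioi 0))).exists
    have hδ' : (0 : ℝ) < δ := hδ
    have h3 : (p + δ • w, t + δ) ∈ D := by
      refine hDmem _ a1 _ (by linarith) ?_
      convert a2 using 1
      rw [← huw]
      module
    have h4 : t + δ ≤ t := hmax h3
    linarith

theorem exists_add_smul_sub_mem_of_mem_intrinsicInterior {G : Set E} {z p : E}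
    (hz : z ∈ intrinsicInterior ℝ G) (hp : p ∈ G) : ∃ δ > (0 : ℝ), z + δ • (z - p) ∈ G := by
  obtain ⟨z, hz, rfl⟩ := hz
  have hmem : ∀ δ : ℝ, (z : E) + δ • ((z : E) - p) ∈ affineSpan ℝ G := fun δ => by
    have := AffineMap.lineMap_mem (1 + δ) (subset_affineSpan ℝ G hp) z.2
    convert this using 1
    rw [AffineMap.lineMap_apply]
    simp only [vsub_eq_sub, vadd_eq_add]
    module
  have hcont : Continuous fun δ : ℝ =>
      (⟨(z : E) + δ • ((z : E) - p), hmem δ⟩ : affineSpan ℝ G) := by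
    fun_prop
  have h1 := hcont.continuousAt.eventually_mem (x := 0)
    (s := ((↑) ⁻¹' G : Set (affineSpan ℝ G))) (by simpa using mem_interior_iff_mem_nhds.1 hz)
  obtain ⟨δ, h2, hδ⟩ := ((h1.filter_mono nhdsWithin_le_nhds).and
    (self_mem_nhdsWithin : Set.Ioi (0 : ℝ) ∈ nhdsWithin 0 (Set.Ioi 0))).exists
  exact ⟨δ, hδ, h2⟩

/-- A direction pointing into a convex set from a point of a subset `G` also points into it
from the relative interior of `G`. -/
theorem exists_add_smul_mem_of_mem_intrinsicInterior {Q G : Set E} (hQ : Convex ℝ Q)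
    (hGQ : G ⊆ Q) {z p u : E} (hz : z ∈ intrinsicInterior ℝ G) (hp : p ∈ G) {t : ℝ} (ht : 0 < t)
    (hpt : p + t • u ∈ Q) : ∃ ε > (0 : ℝ), z + ε • u ∈ Q := by
  obtain ⟨δ, hδ, hz'⟩ := exists_add_smul_sub_mem_of_mem_intrinsicInterior hz hp
  have hδ1 : 0 < 1 + δ := by linarith
  refine ⟨δ / (1 + δ) * t, by positivity, ?_⟩
  have := hQ hpt (hGQ hz') (a := δ / (1 + δ)) (b := 1 / (1 + δ)) (by positivity) (by positivity)
    (by field_simp; ring)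
  convert this using 1
  match_scalars <;> (field_simp; try ring)

open Classical in
theorem IsConeFace.choose_le_card_directions [FiniteDimensional ℝ E] {V S : Finset E} {p u : E}
    (hp : p ∈ convexHull ℝ (V : Set E))
    (hdim : dimSet (convexHull ℝ (V : Set E)) = Module.finrank ℝ E)
    (h : IsConeFace (fun v => v - p) V S) {k : ℕ} (hk : k ≤ Module.finrank ℝ E)
    {t : ℝ} (ht : 0 < t) (hpt : p + t • u ∈ convexHull ℝ (V : Set E))
    {F : Finset (Set E)} (hF : ∀ G, G ∈ F ↔ IsKFace (convexHull ℝ (V : Set E)) k G)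
    {z : Set E → E} (hz : ∀ G ∈ F, z G ∈ intrinsicInterior ℝ G) :
    (Module.finrank ℝ E - coneRank (fun v => v - p) S).choose (Module.finrank ℝ E - k) ≤
      (F.filter fun G => ∃ ε > (0 : ℝ), z G + ε • u ∈ convexHull ℝ (V : Set E)).card := by
  have hV : coneRank (fun v => v - p) V = Module.finrank ℝ E := by
    rw [← hdim, dimSet_convexHull_eq_coneRank hp]
  have h1 := h.choose_le_card (k := k) (hV ▸ hk)
  rw [hV] at h1
  refine h1.trans (Finset.card_le_card_of_injOn (fun T => convexHull ℝ (T : Set E)) ?_ ?_)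
  · intro T hT
    simp only [Finset.coe_filter, Finset.mem_powerset, Set.mem_ofPred_eq] at hT ⊢
    obtain ⟨hTV, hT, -, hTk⟩ := hT
    have hmem : convexHull ℝ (T : Set E) ∈ F := (hF _).2 (hTk ▸ hT.isKFace hp)
    exact ⟨hmem, exists_add_smul_mem_of_mem_intrinsicInterior (convex_convexHull ℝ _)
      (convexHull_mono (by exact_mod_cast hTV)) (hz _ hmem) (hT.mem_convexHull hp) ht hpt⟩
  · have aux : ∀ T T' : Finset E, IsConeFace (fun v => v - p) V T →
        IsConeFace (fun v => v - p) V T' →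
        convexHull ℝ (T : Set E) = convexHull ℝ (T' : Set E) → T ⊆ T' := by
      intro T T' hT hT' heq v hv
      obtain ⟨f, -, hG, hf⟩ := hT'.exists_convexHull_eq
      have h2 : v ∈ convexHull ℝ (T' : Set E) := heq ▸ subset_convexHull ℝ _ hv
      rw [hG] at h2
      exact (hf v).2 ⟨hT.subset hv, h2.2⟩
    intro T hT T' hT' heq
    simp only [Finset.coe_filter, Finset.mem_powerset, Set.mem_ofPred_eq] at hT hT'
    exact Finset.Subset.antisymm (aux T T' hT.2.1 hT'.2.1 heq) (aux T' T hT'.2.1 hT.2.1 heq.symm)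

open Classical in
/-- For every direction `u`, many `k`-faces have `u` or `-u` pointing into the polytope. -/
theorem choose_add_choose_le_card_directions [FiniteDimensional ℝ E] {V : Finset E}
    (hdim : dimSet (convexHull ℝ (V : Set E)) = Module.finrank ℝ E) {k : ℕ}
    (hk : k < Module.finrank ℝ E) {F : Finset (Set E)}
    (hF : ∀ G, G ∈ F ↔ IsKFace (convexHull ℝ (V : Set E)) k G)
    {z : Set E → E} (hz : ∀ G ∈ F, z G ∈ intrinsicInterior ℝ G) (u : E) :
    ((Module.finrank ℝ E + 2) / 2).choose (Module.finrank ℝ E - k) +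
      ((Module.finrank ℝ E + 1) / 2).choose (Module.finrank ℝ E - k) ≤
      (F.filter fun G => ∃ ε > (0 : ℝ), z G + ε • u ∈ convexHull ℝ (V : Set E)).card +
      (F.filter fun G => ∃ ε > (0 : ℝ), z G + ε • (-u) ∈ convexHull ℝ (V : Set E)).card := by
  wlog hu : u ≠ 0 generalizing u
  · rw [not_not] at hu
    subst hu
    have hnt : Nontrivial E := Module.nontrivial_of_finrank_pos (R := ℝ) (by omega)
    obtain ⟨v, hv⟩ := exists_ne (0 : E)
    have hall : (F.filter fun G => ∃ ε > (0 : ℝ), z G + ε • (0 : E) ∈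
        convexHull ℝ (V : Set E)) = F := by
      refine Finset.filter_true_of_mem fun G hG => ⟨1, one_pos, ?_⟩
      have h1 : G ⊆ convexHull ℝ (V : Set E) := by
        rcases ((hF G).1 hG).1 with rfl | rfl | ⟨f, -, c, -, rfl⟩
        · exact subset_rfl
        · exact Set.empty_subset _
        · exact Set.sep_subset _ _
      simpa using h1 (intrinsicInterior_subset (hz G hG))
    rw [neg_zero, hall]
    exact (this v hv).trans
      (add_le_add (Finset.card_filter_le _ _) (Finset.card_filter_le _ _))
  have hVne : (convexHull ℝ (V : Set E)).Nonempty := by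
    rw [Set.nonempty_iff_ne_empty]
    intro h0
    rw [dimSet, h0, AffineSubspace.span_empty, AffineSubspace.direction_bot ℝ E E, finrank_bot ℝ E] at hdim
    omega
  have hint : (interior (convexHull ℝ (V : Set E))).Nonempty := by
    rw [(convex_convexHull ℝ _).interior_nonempty_iff_affineSpan_eq_top,
      AffineSubspace.affineSpan_eq_top_iff_vectorSpan_eq_top_of_nonempty _ _ _ hVne,
      ← direction_affineSpan]
    exact Submodule.eq_top_of_finrank_eq hdim
  obtain ⟨p, hp, t, ht, hq, hpq, hapart⟩ :=
    exists_longest_chord (V.finite_toSet.isCompact_convexHull ℝ) hint hu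
  obtain ⟨S, hS, hSmem⟩ := exists_isConeFace_eventually_mem hp
  obtain ⟨T, hT, hTmem⟩ := exists_isConeFace_eventually_mem hq
  have h1 := hS.choose_le_card_directions hp hdim hk.le ht hq hF hz
  have h2 := hT.choose_le_card_directions (u := -u) hq hdim hk.le ht (by simpa using hp) hF hz
  refine le_trans ?_ (add_le_add h1 h2)
  refine choose_half_add_choose_half_le (d := Module.finrank ℝ E + 1) ?_
  have hinf : Submodule.span ℝ ((fun v => v - p) '' (S : Set E)) ⊓
      Submodule.span ℝ ((fun v => v - (p + t • u)) '' (T : Set E)) = ⊥ :=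
    (Submodule.eq_bot_iff _).2 fun w hw => hpq w (hSmem w hw.1) (hTmem w hw.2)
  have hsup : Submodule.span ℝ ((fun v => v - p) '' (S : Set E)) ⊔
      Submodule.span ℝ ((fun v => v - (p + t • u)) '' (T : Set E)) < ⊤ := by
    refine lt_top_iff_ne_top.2 fun htop => ?_
    obtain ⟨x, hx, y, hy, hxy⟩ := Submodule.mem_sup.1 (htop ▸ Submodule.mem_top : u ∈ _)
    refine hapart (-x) y (hSmem _ (neg_mem hx)) (hTmem _ hy) ?_
    rw [← hxy]
    abel
  have h3 := Submodule.finrank_lt hsup.ne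
  have h4 := Submodule.finrank_sup_add_finrank_inf_eq
    (Submodule.span ℝ ((fun v => v - p) '' (S : Set E)))
    (Submodule.span ℝ ((fun v => v - (p + t • u)) '' (T : Set E)))
  rw [hinf, finrank_bot ℝ E, add_zero] at h4
  unfold coneRank
  omega

end Polytope

section SolidAngle

open MeasureTheory Pointwise

variable {n : ℕ}

theorem volume_ball_inter_div (Q : Set (Euc n)) (z : Euc n) {r : ℝ} (hr : 0 < r) :
    volume (Metric.ball z r ∩ Q) / volume (Metric.ball z r) =
      volume (Metric.ball 0 1 ∩ {u | z + r • u ∈ Q}) / volume (Metric.ball (0 : Euc n) 1) := by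
  have h1 : Metric.ball z r = {z} + r • Metric.ball (0 : Euc n) 1 := by
    rw [smul_unitBall_of_pos hr, singleton_add_ball, add_zero]
  have h2 : Metric.ball z r ∩ Q =
      {z} + r • (Metric.ball (0 : Euc n) 1 ∩ {u | z + r • u ∈ Q}) := by
    ext x
    simp only [Set.singleton_add, Set.image_add_left, Set.mem_inter_iff, Set.mem_preimage,
      Set.mem_smul_set_iff_inv_smul_mem₀ hr.ne', Set.mem_ofPred_eq, smul_inv_smul₀ hr.ne',
      neg_add_eq_sub, mem_ball_iff_norm, sub_zero, norm_smul, norm_inv,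
      Real.norm_of_nonneg hr.le, inv_mul_lt_iff₀ hr, mul_one]
    rw [add_sub_cancel]
  rw [h2, h1, Measure.addHaar_singleton_add_smul_div_singleton_add_smul _ hr.ne']

/-- The solid angle is the normalized volume of the tangent cone. -/
theorem IsSolidAngle.volume_eq {Q G : Set (Euc n)} {a : ℝ} (h : IsSolidAngle Q G a)
    (hQ : Convex ℝ Q) (hGQ : G ⊆ Q) {z : Euc n} (hz : z ∈ intrinsicInterior ℝ G) :
    0 ≤ a ∧ volume (Metric.ball 0 1 ∩ {u | ∃ ε > (0 : ℝ), z + ε • u ∈ Q}) =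
      ENNReal.ofReal a * volume (Metric.ball (0 : Euc n) 1) := by
  have hzQ := hGQ (intrinsicInterior_subset hz)
  have hB0 : volume (Metric.ball (0 : Euc n) 1) ≠ 0 :=
    (Metric.measure_ball_pos _ _ one_pos).ne'
  have hBtop : volume (Metric.ball (0 : Euc n) 1) ≠ ⊤ := measure_ball_lt_top.ne
  set s : ℕ → Set (Euc n) := fun m =>
    Metric.ball 0 1 ∩ {u | z + (1 / ((m : ℝ) + 1)) • u ∈ Q} with hs
  have hscale : ∀ u : Euc n, ∀ ε δ : ℝ, 0 ≤ δ → δ ≤ ε → z + ε • u ∈ Q → z + δ • u ∈ Q := by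
    intro u ε δ hδ hδε hu
    rcases hδ.eq_or_lt with rfl | hδ
    · simpa using hzQ
    have hε := hδ.trans_le hδε
    have := hQ.add_smul_mem hzQ hu (t := δ / ε) ⟨by positivity, (div_le_one hε).2 hδε⟩
    rwa [smul_smul, div_mul_cancel₀ _ hε.ne'] at this
  have hmono : Monotone s := by
    intro m m' hm u hu
    exact ⟨hu.1, hscale u _ _ (by positivity) (one_div_le_one_div_of_le (by positivity)
      (by exact_mod_cast Nat.succ_le_succ hm)) hu.2⟩
  have hunion : ⋃ m, s m = Metric.ball 0 1 ∩ {u | ∃ ε > (0 : ℝ), z + ε • u ∈ Q} := by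
    ext u
    simp only [hs, Set.mem_iUnion, Set.mem_inter_iff, Set.mem_ofPred_eq]
    constructor
    · rintro ⟨m, hu, hm⟩
      exact ⟨hu, _, by positivity, hm⟩
    · rintro ⟨hu, ε, hε, hm⟩
      obtain ⟨m, hm'⟩ := exists_nat_one_div_lt hε
      exact ⟨m, hu, hscale u _ _ (by positivity) hm'.le hm⟩
  have hlim := tendsto_measure_iUnion_atTop (μ := volume) hmono
  rw [hunion] at hlim
  have hr : Filter.Tendsto (fun m : ℕ => 1 / ((m : ℝ) + 1)) Filter.atTop
      (nhdsWithin 0 (Set.Ioi 0)) :=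
    tendsto_nhdsWithin_iff.2 ⟨tendsto_one_div_add_atTop_nhds_zero_nat,
      Filter.Eventually.of_forall fun m => Set.mem_Ioi.2 (by positivity)⟩
  have hev : ∀ᶠ m in Filter.atTop, 0 ≤ a ∧
      volume (s m) = ENNReal.ofReal a * volume (Metric.ball (0 : Euc n) 1) := by
    filter_upwards [hr.eventually (h z hz)] with m hm
    have hpos : (0 : ℝ) < 1 / ((m : ℝ) + 1) := by positivity
    rw [← ENNReal.toReal_div, volume_ball_inter_div Q z hpos] at hm
    refine ⟨hm ▸ ENNReal.toReal_nonneg, ?_⟩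
    rw [← hm, ENNReal.ofReal_toReal, ENNReal.div_mul_cancel hB0 hBtop]
    exact ENNReal.div_ne_top (measure_ne_top_of_subset Set.inter_subset_left hBtop) hB0
  obtain ⟨m, ha, -⟩ := hev.exists
  exact ⟨ha, tendsto_nhds_unique hlim
    (tendsto_const_nhds.congr' (hev.mono fun m hm => hm.2.symm))⟩

theorem measurableSet_tangentDirections {Q : Set (Euc n)} (hQ : Convex ℝ Q) (hQc : IsClosed Q)
    {z : Euc n} (hz : z ∈ Q) : MeasurableSet {u : Euc n | ∃ ε > (0 : ℝ), z + ε • u ∈ Q} := by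
  have : {u : Euc n | ∃ ε > (0 : ℝ), z + ε • u ∈ Q} =
      ⋃ m : ℕ, {u | z + (1 / ((m : ℝ) + 1)) • u ∈ Q} := by
    ext u
    simp only [Set.mem_iUnion, Set.mem_ofPred_eq]
    constructor
    · rintro ⟨ε, hε, hu⟩
      obtain ⟨m, hm⟩ := exists_nat_one_div_lt hε
      refine ⟨m, ?_⟩
      have := hQ.add_smul_mem hz hu (t := 1 / ((m : ℝ) + 1) / ε)
        ⟨by positivity, (div_le_one hε).2 hm.le⟩
      rwa [smul_smul, div_mul_cancel₀ _ hε.ne'] at this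
    · rintro ⟨m, hm⟩
      exact ⟨_, by positivity, hm⟩
  rw [this]
  exact MeasurableSet.iUnion fun m => (hQc.preimage (by fun_prop)).measurableSet

open Classical in
/-- If a family of measurable sets `C i` and their reflections cover every point of the unit ball
at least `c` times, their volumes within the ball sum to at least `c / 2` times its volume. -/
theorem le_two_mul_sum_volume_inter_ball {ι : Type*} {F : Finset ι} {C : ι → Set (Euc n)}
    (hC : ∀ i ∈ F, MeasurableSet (C i)) {c : ℕ}
    (hcover : ∀ u, c ≤ (F.filter fun i => u ∈ C i).card + (F.filter fun i => -u ∈ C i).card) :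
    c * volume (Metric.ball (0 : Euc n) 1) ≤
      2 * ∑ i ∈ F, volume (Metric.ball (0 : Euc n) 1 ∩ C i) := by
  have hneg : ∀ i, volume (Metric.ball (0 : Euc n) 1 ∩ (-C i)) =
      volume (Metric.ball (0 : Euc n) 1 ∩ C i) := fun i => by
    rw [← Measure.measure_neg volume (Metric.ball (0 : Euc n) 1 ∩ C i), Set.inter_neg, neg_ball,
      neg_zero]
  have hcount : ∀ (D : ι → Set (Euc n)) (u : Euc n),
      ((F.filter fun i => u ∈ D i).card : ENNReal) = ∑ i ∈ F, (D i).indicator 1 u := by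
    simp [Set.indicator_apply]
  have hsum : ∀ D : ι → Set (Euc n), (∀ i ∈ F, MeasurableSet (D i)) →
      ∑ i ∈ F, volume (Metric.ball (0 : Euc n) 1 ∩ D i) =
        ∫⁻ u in Metric.ball (0 : Euc n) 1, ((F.filter fun i => u ∈ D i).card : ENNReal) := by
    intro D hD
    simp only [hcount]
    rw [lintegral_finsetSum' _ fun i hi => (measurable_one.indicator (hD i hi)).aemeasurable]
    refine Finset.sum_congr rfl fun i hi => ?_
    rw [lintegral_indicator_one (hD i hi), Measure.restrict_apply (hD i hi), Set.inter_comm]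
  calc c * volume (Metric.ball (0 : Euc n) 1)
      = ∫⁻ _ in Metric.ball (0 : Euc n) 1, (c : ENNReal) := by rw [setLIntegral_const]
    _ ≤ ∫⁻ u in Metric.ball (0 : Euc n) 1, (((F.filter fun i => u ∈ C i).card : ENNReal) +
          ((F.filter fun i => u ∈ -C i).card : ENNReal)) :=
        lintegral_mono fun u => by
          simp only [Set.mem_neg]
          exact_mod_cast hcover u
    _ ≤ 2 * ∑ i ∈ F, volume (Metric.ball (0 : Euc n) 1 ∩ C i) := by
        rw [lintegral_add_left', ← hsum C hC, ← hsum (fun i => -C i) fun i hi => (hC i hi).neg,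
          two_mul]
        · simp only [hneg, le_refl]
        · simp only [hcount]
          exact Finset.aemeasurable_fun_sum _
            fun i hi => (measurable_one.indicator (hC i hi)).aemeasurable

end SolidAngle

/-- For `d ≥ 1`, a `(d-1)`-polytope `Q` (realized full-dimensionally
in `ℝ^{d-1}`, which loses no generality since solid angles are isometry invariants),
and `0 ≤ k ≤ d-2`: `φ_k(Q) ≥ ρ(d, d-k-1)`. -/
theorem solid_angle_sum_lower_bound (d : ℕ) (hd : 1 ≤ d) (Q : Set (Euc (d - 1)))
    (hQ : IsPolytope Q) (hQdim : dimSet Q = d - 1) (k : ℕ) (hk : k + 2 ≤ d)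
    (s : ℝ) (hs : IsSolidAngleSum Q k s) :
    ((rho d (d - k - 1) : ℚ) : ℝ) ≤ s := by
  classical
  obtain ⟨V, rfl⟩ := hQ
  obtain ⟨F, a, hF, ha, rfl⟩ := hs
  have hF' : ∀ G, G ∈ F ↔ IsKFace (convexHull ℝ (V : Set (Euc (d - 1)))) k G := fun G => by
    rw [← Finset.mem_coe, hF]
    rfl
  have hsub : ∀ G ∈ F, G ⊆ convexHull ℝ (V : Set (Euc (d - 1))) := fun G hG => by
    rcases ((hF' G).1 hG).1 with rfl | rfl | ⟨f, -, c, -, rfl⟩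
    · exact subset_rfl
    · exact Set.empty_subset _
    · exact Set.sep_subset _ _
  have hz : ∀ G ∈ F, ∃ z, z ∈ intrinsicInterior ℝ G := fun G hG => by
    refine (intrinsicInterior_nonempty ?_).2 ((hF' G).1 hG).2.1
    rcases ((hF' G).1 hG).1 with rfl | rfl | ⟨f, -, c, -, rfl⟩
    · exact convex_convexHull ℝ _
    · exact convex_empty
    · exact (convex_convexHull ℝ _).inter (convex_hyperplane f.toLinearMap.isLinear c)
  choose! z hz using hz
  have hfin : Module.finrank ℝ (Euc (d - 1)) = d - 1 := by simp
  have hcard := choose_add_choose_le_card_directions (hQdim.trans hfin.symm) (k := k)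
    (by omega) hF' hz
  have hvol := fun G (hG : G ∈ F) =>
    (ha G hG).volume_eq (convex_convexHull ℝ _) (hsub G hG) (hz G hG)
  have hmain := le_two_mul_sum_volume_inter_ball (F := F)
    (C := fun G => {u | ∃ ε > (0 : ℝ), z G + ε • u ∈ convexHull ℝ (V : Set (Euc (d - 1)))})
    (fun G hG => measurableSet_tangentDirections (convex_convexHull ℝ _)
      (V.finite_toSet.isClosed_convexHull ℝ) (hsub G hG (intrinsicInterior_subset (hz G hG)))) hcard
  rw [Finset.sum_congr rfl fun G hG => (hvol G hG).2, ← Finset.sum_mul, ← mul_assoc,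
    ENNReal.mul_le_mul_iff_left (Metric.measure_ball_pos _ _ one_pos).ne'
      MeasureTheory.measure_ball_lt_top.ne,
    ← ENNReal.ofReal_sum_of_nonneg fun G hG => (hvol G hG).1] at hmain
  have hnonneg : 0 ≤ ∑ G ∈ F, a G := Finset.sum_nonneg fun G hG => (hvol G hG).1
  have hreal := ENNReal.toReal_mono (by finiteness) hmain
  rw [ENNReal.toReal_mul, ENNReal.toReal_ofReal hnonneg, ENNReal.toReal_natCast, hfin,
    show d - 1 + 2 = d + 1 by omega, show d - 1 + 1 = d by omega,
    show d - 1 - k = d - k - 1 by omega] at hreal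
  unfold rho
  push_cast at hreal ⊢
  simp only [ENNReal.toReal_ofNat] at hreal
  linarith
end
end

section
/- Let d ≥ 1, 0 ≤ k ≤ d−1, and ε > 0 be a real number. Then there exists a d-polytope Q such that f_k(Q) < (ρ(d, d−k−1) + ε) · f_{d−1}(Q). -/
noncomputable section

open Classical in
/-- A family `𝓕` of subsets of a finite vector configuration `v` on `A` which contains every set of
vectors cut out by a supporting hyperplane of the configuration not through the origin; the origin
is an interior point of the convex hull, and every member of `𝓕` is linearly independent. The
members of `𝓕` of full size are required to be cut out by supporting hyperplanes. -/
structure IsSimplicialConfig {E J : Type*} [AddCommGroup E] [Module ℝ E]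
    (v : J → E) (A : Finset J) (𝓕 : Finset (Finset J)) : Prop where
  subset : ∀ S ∈ 𝓕, S ⊆ A
  linearIndepOn : ∀ S ∈ 𝓕, LinearIndepOn ℝ v (S : Set J)
  eq_zero : ∀ g : E →ₗ[ℝ] ℝ, (∀ x ∈ A, g (v x) ≤ 0) → g = 0
  filter_mem : ∀ (g : E →ₗ[ℝ] ℝ) (c : ℝ), 0 < c → (∀ x ∈ A, g (v x) ≤ c) →
    {x ∈ A | g (v x) = c} ∈ 𝓕
  exists_support : ∀ S ∈ 𝓕, S.card = Module.finrank ℝ E →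
    ∃ g : E →ₗ[ℝ] ℝ, ∀ x ∈ A, g (v x) ≤ 1 ∧ (g (v x) = 1 ↔ x ∈ S)

section ConvexHull

variable {E J : Type*} [NormedAddCommGroup E] [InnerProductSpace ℝ E]

theorem le_of_mem_convexHull_image (v : J → E) (A : Set J) (f : E →L[ℝ] ℝ) (c : ℝ)
    (h : ∀ x ∈ A, f (v x) ≤ c) : ∀ y ∈ convexHull ℝ (v '' A), f y ≤ c := by
  have hs : convexHull ℝ (v '' A) ⊆ {y | f y ≤ c} := by
    refine convexHull_min ?_ (convex_halfSpace_le f.toLinearMap.isLinear c)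
    rintro _ ⟨x, hx, rfl⟩
    exact h x hx
  exact hs

theorem sep_convexHull_image_eq (v : J → E) (A : Finset J) (f : E →L[ℝ] ℝ) (c : ℝ)
    (h : ∀ x ∈ A, f (v x) ≤ c) :
    {y ∈ convexHull ℝ (v '' (A : Set J)) | f y = c} =
      convexHull ℝ (v '' {x | x ∈ A ∧ f (v x) = c}) := by
  classical
  apply Set.Subset.antisymm
  · rintro y ⟨hy, hyc⟩
    rw [← Finset.coe_image, Finset.mem_convexHull'] at hy
    obtain ⟨w, hw0, hw1, rfl⟩ := hy
    have hle : ∀ z ∈ A.image v, f z ≤ c := by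
      intro z hz
      obtain ⟨x, hx, rfl⟩ := Finset.mem_image.1 hz
      exact h x hx
    have hsum : ∑ z ∈ A.image v, w z * (c - f z) = 0 := by
      simp only [map_sum, map_smul, smul_eq_mul] at hyc
      simp only [mul_sub, Finset.sum_sub_distrib, hyc, ← Finset.sum_mul, hw1]
      ring
    rw [Finset.sum_eq_zero_iff_of_nonneg
      fun z hz => mul_nonneg (hw0 z hz) (sub_nonneg.2 (hle z hz))] at hsum
    have hzero : ∀ z ∈ A.image v, f z ≠ c → w z = 0 := by
      intro z hz hzc
      rcases mul_eq_zero.1 (hsum z hz) with h0 | h0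
      · exact h0
      · exact absurd (sub_eq_zero.1 h0).symm hzc
    have himage : (v '' {x | x ∈ A ∧ f (v x) = c}) =
        (((A.image v).filter fun z => f z = c : Finset E) : Set E) := by
      ext z
      simp only [Set.mem_image, Set.mem_ofPred_eq, Finset.coe_filter, Finset.mem_image]
      constructor
      · rintro ⟨x, ⟨hx, hc⟩, rfl⟩
        exact ⟨⟨x, hx, rfl⟩, hc⟩
      · rintro ⟨⟨x, hx, rfl⟩, hc⟩
        exact ⟨x, ⟨hx, hc⟩, rfl⟩
    rw [himage, Finset.mem_convexHull']
    refine ⟨w, fun z hz => hw0 z (Finset.mem_filter.1 hz).1, ?_, ?_⟩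
    · rw [← hw1]
      refine Finset.sum_filter_of_ne fun z hz hne => ?_
      by_contra hzc
      exact hne (hzero z hz hzc)
    · refine Finset.sum_filter_of_ne fun z hz hne => ?_
      by_contra hzc
      exact hne (by rw [hzero z hz hzc, zero_smul])
  · refine convexHull_min ?_
      ((convex_convexHull ℝ _).inter (convex_hyperplane f.toLinearMap.isLinear c))
    rintro _ ⟨x, ⟨hx, hc⟩, rfl⟩
    exact ⟨subset_convexHull ℝ _ ⟨x, hx, rfl⟩, hc⟩

theorem dimSet_convexHull_image_of_linearIndepOn {v : J → E} {S : Finset J} {k : ℕ}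
    (h : LinearIndepOn ℝ v (S : Set J)) (hS : S.card = k + 1) :
    dimSet (convexHull ℝ (v '' (S : Set J))) = k := by
  have hlin : LinearIndependent ℝ fun x : (S : Set J) => v x := h
  have haff := hlin.affineIndependent ℝ
  have := haff.finrank_vectorSpan (n := k) (by simpa using hS)
  rw [dimSet, affineSpan_convexHull, direction_affineSpan, Set.image_eq_range]
  exact this

end ConvexHull

namespace IsSimplicialConfig

section Faces

variable {E J : Type*} [NormedAddCommGroup E] [InnerProductSpace ℝ E]
  {v : J → E} {A : Finset J} {𝓕 : Finset (Finset J)}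

theorem eq_zero_of_const (h : IsSimplicialConfig v A 𝓕) (g : E →ₗ[ℝ] ℝ) (c : ℝ)
    (hg : ∀ x ∈ A, g (v x) = c) : g = 0 := by
  rcases le_total c 0 with hc | hc
  · exact h.eq_zero g fun x hx => (hg x hx).trans_le hc
  · exact neg_eq_zero.1 (h.eq_zero (-g) fun x hx => by simpa [hg x hx] using hc)

theorem dimSet_convexHull (h : IsSimplicialConfig v A 𝓕) :
    dimSet (convexHull ℝ (v '' (A : Set J))) = Module.finrank ℝ E := by
  rw [dimSet, affineSpan_convexHull, direction_affineSpan]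
  suffices hs : vectorSpan ℝ (v '' (A : Set J)) = ⊤ by rw [hs, finrank_top]
  by_contra hne
  obtain ⟨f, hf, hle⟩ := Submodule.exists_le_ker_of_lt_top _ (lt_top_iff_ne_top.2 hne)
  apply hf
  rcases A.eq_empty_or_nonempty with rfl | ⟨x₀, hx₀⟩
  · exact h.eq_zero f (by simp)
  · refine h.eq_zero_of_const f (f (v x₀)) fun x hx => ?_
    have : v x -ᵥ v x₀ ∈ vectorSpan ℝ (v '' (A : Set J)) :=
      vsub_mem_vectorSpan ℝ ⟨x, hx, rfl⟩ ⟨x₀, hx₀, rfl⟩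
    have := hle this
    rw [LinearMap.mem_ker, vsub_eq_sub, map_sub] at this
    linarith

/-- Every proper nonempty face is spanned by a member of the family. -/
theorem exists_eq_convexHull_of_isKFace (h : IsSimplicialConfig v A 𝓕) {k : ℕ}
    (hk : k < Module.finrank ℝ E) {G : Set E}
    (hG : IsKFace (convexHull ℝ (v '' (A : Set J))) k G) :
    ∃ S ∈ 𝓕, S.card = k + 1 ∧ G = convexHull ℝ (v '' (S : Set J)) := by
  classical
  obtain ⟨hface, hne, hdim⟩ := hG
  rcases hface with rfl | rfl | ⟨f, hf, c, hle, rfl⟩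
  · rw [h.dimSet_convexHull] at hdim
    omega
  · exact absurd hne Set.not_nonempty_empty
  · have hleA : ∀ x ∈ A, f (v x) ≤ c := fun x hx => hle _ (subset_convexHull ℝ _ ⟨x, hx, rfl⟩)
    have hc : 0 < c := by
      by_contra hc
      have := h.eq_zero f.toLinearMap fun x hx => (hleA x hx).trans (not_lt.1 hc)
      exact hf (ContinuousLinearMap.coe_injective this)
    have hmem := h.filter_mem f.toLinearMap c hc hleA
    have heq := sep_convexHull_image_eq v A f c hleA
    rw [heq] at hne hdim ⊢
    set S : Finset J := {x ∈ A | f.toLinearMap (v x) = c} with hS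
    have hcoe : {x | x ∈ A ∧ f (v x) = c} = (S : Set J) := by
      ext x
      simp [hS]
    rw [hcoe] at hne hdim ⊢
    refine ⟨S, by convert hmem, ?_, rfl⟩
    have hSne : S.Nonempty := by
      rw [convexHull_nonempty_iff, Set.image_nonempty] at hne
      exact_mod_cast hne
    obtain ⟨j, hj⟩ := Nat.exists_eq_succ_of_ne_zero hSne.card_pos.ne'
    have hSj : S.card = j + 1 := hj
    rw [← hdim, dimSet_convexHull_image_of_linearIndepOn (h.linearIndepOn S (by convert hmem)) hSj,
      hSj]

theorem setOf_isKFace_subset (h : IsSimplicialConfig v A 𝓕) {k : ℕ}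
    (hk : k < Module.finrank ℝ E) :
    {G | IsKFace (convexHull ℝ (v '' (A : Set J))) k G} ⊆
      (fun S : Finset J => convexHull ℝ (v '' (S : Set J))) ''
        ({S ∈ 𝓕 | S.card = k + 1} : Finset (Finset J)) := by
  intro G hG
  obtain ⟨S, hS, hcard, rfl⟩ := h.exists_eq_convexHull_of_isKFace hk hG
  exact ⟨S, by simp [hS, hcard], rfl⟩

theorem fVec_le (h : IsSimplicialConfig v A 𝓕) {k : ℕ} (hk : k < Module.finrank ℝ E) :
    fVec (convexHull ℝ (v '' (A : Set J))) k ≤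
      ({S ∈ 𝓕 | S.card = k + 1} : Finset (Finset J)).card := by
  rw [fVec]
  refine (Set.ncard_le_ncard (h.setOf_isKFace_subset hk)
    ((Finset.finite_toSet _).image _)).trans ?_
  refine (Set.ncard_image_le (Finset.finite_toSet _)).trans ?_
  rw [Set.ncard_coe_finset]

theorem le_fVec [FiniteDimensional ℝ E] (h : IsSimplicialConfig v A 𝓕) {k : ℕ} (hk : k + 1 = Module.finrank ℝ E) :
    ({S ∈ 𝓕 | S.card = k + 1} : Finset (Finset J)).card ≤
      fVec (convexHull ℝ (v '' (A : Set J))) k := by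
  classical
  rw [fVec, ← Set.ncard_coe_finset]
  have hfin : {G | IsKFace (convexHull ℝ (v '' (A : Set J))) k G}.Finite :=
    ((Finset.finite_toSet _).image _).subset (h.setOf_isKFace_subset (by omega))
  have hsupp : ∀ S ∈ ({S ∈ 𝓕 | S.card = k + 1} : Finset (Finset J)),
      ∃ f : E →L[ℝ] ℝ, (∀ x ∈ A, f (v x) ≤ 1) ∧ (∀ x ∈ A, f (v x) = 1 ↔ x ∈ S) ∧
        convexHull ℝ (v '' (S : Set J)) =
          {y ∈ convexHull ℝ (v '' (A : Set J)) | f y = 1} := by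
    intro S hS
    obtain ⟨hS, hcard⟩ := Finset.mem_filter.1 hS
    obtain ⟨g, hg⟩ := h.exists_support S hS (hcard.trans hk)
    refine ⟨LinearMap.toContinuousLinearMap g, fun x hx => (hg x hx).1,
      fun x hx => (hg x hx).2, ?_⟩
    rw [sep_convexHull_image_eq _ _ _ _ fun x hx => (hg x hx).1]
    congr 2
    ext x
    constructor
    · exact fun hx => ⟨h.subset S hS hx, ((hg x (h.subset S hS hx)).2).2 hx⟩
    · exact fun hx => ((hg x hx.1).2).1 hx.2
  refine Set.ncard_le_ncard_of_injOn (fun S : Finset J => convexHull ℝ (v '' (S : Set J)))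
    ?_ ?_ hfin
  · intro S hS
    obtain ⟨f, hf, hfS, heq⟩ := hsupp S hS
    obtain ⟨hS, hcard⟩ := Finset.mem_filter.1 hS
    have hSne : S.Nonempty := Finset.card_pos.1 (by omega)
    refine ⟨Or.inr (Or.inr ⟨f, ?_, 1, le_of_mem_convexHull_image _ _ _ _ hf, heq⟩), ?_,
      dimSet_convexHull_image_of_linearIndepOn (h.linearIndepOn S hS) hcard⟩
    · rintro rfl
      obtain ⟨x, hx⟩ := hSne
      simpa using (hfS x (h.subset S hS hx)).2 hx
    · rw [convexHull_nonempty_iff, Set.image_nonempty]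
      exact_mod_cast hSne
  · intro S hS T hT hST
    obtain ⟨f, -, hfS, heS⟩ := hsupp S hS
    obtain ⟨g, -, hgT, heT⟩ := hsupp T hT
    have hSA := h.subset S (Finset.mem_filter.1 hS).1
    have hTA := h.subset T (Finset.mem_filter.1 hT).1
    simp only at hST
    apply Finset.Subset.antisymm
    · intro x hx
      have hxS : v x ∈ convexHull ℝ (v '' (S : Set J)) := subset_convexHull ℝ _ ⟨x, hx, rfl⟩
      rw [hST, heT] at hxS
      exact (hgT x (hSA hx)).1 hxS.2
    · intro x hx
      have hxT : v x ∈ convexHull ℝ (v '' (T : Set J)) := subset_convexHull ℝ _ ⟨x, hx, rfl⟩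
      rw [← hST, heS] at hxT
      exact (hfS x (hTA hx)).1 hxT.2

end Faces

section Operations

variable {E E' J J' : Type*} [AddCommGroup E] [Module ℝ E] [AddCommGroup E'] [Module ℝ E']
  {v : J → E} {A : Finset J} {𝓕 : Finset (Finset J)}
  {v' : J' → E'} {A' : Finset J'} {𝓕' : Finset (Finset J')}

theorem map (h : IsSimplicialConfig v A 𝓕) (e : E ≃ₗ[ℝ] E') :
    IsSimplicialConfig (e ∘ v) A 𝓕 where
  subset := h.subset
  linearIndepOn S hS := (h.linearIndepOn S hS).map_injOn e.toLinearMap e.injective.injOn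
  eq_zero g hg := by
    have := h.eq_zero (g ∘ₗ e.toLinearMap) hg
    ext y
    simpa using LinearMap.congr_fun this (e.symm y)
  filter_mem g c hc hg := h.filter_mem (g ∘ₗ e.toLinearMap) c hc hg
  exists_support S hS hcard := by
    obtain ⟨g, hg⟩ := h.exists_support S hS (hcard.trans e.finrank_eq.symm)
    exact ⟨g ∘ₗ e.symm.toLinearMap, fun x hx => by simpa using hg x hx⟩

/-- The disjoint sum of finsets as an embedding of the product. -/
def disjSumEmbedding (J J' : Type*) : Finset J × Finset J' ↪ Finset (J ⊕ J') where
  toFun p := p.1.disjSum p.2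
  inj' := fun _ _ hpq => Prod.ext_iff.2 (Finset.disjSum_inj.1 hpq)

@[simp]
theorem disjSumEmbedding_apply (p : Finset J × Finset J') :
    disjSumEmbedding J J' p = p.1.disjSum p.2 := rfl

/-- The configuration of the free sum of two polytopes. -/
theorem prod [FiniteDimensional ℝ E] [FiniteDimensional ℝ E']
    (h : IsSimplicialConfig v A 𝓕) (h' : IsSimplicialConfig v' A' 𝓕') :
    IsSimplicialConfig (Sum.elim (LinearMap.inl ℝ E E' ∘ v) (LinearMap.inr ℝ E E' ∘ v'))
      (A.disjSum A') ((𝓕 ×ˢ 𝓕').map (disjSumEmbedding J J')) where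
  subset S hS := by
    simp only [Finset.mem_map, Finset.mem_product, disjSumEmbedding_apply] at hS
    obtain ⟨⟨T, T'⟩, ⟨hT, hT'⟩, rfl⟩ := hS
    exact Finset.disjSum_mono (h.subset T hT) (h'.subset T' hT')
  linearIndepOn S hS := by
    simp only [Finset.mem_map, Finset.mem_product, disjSumEmbedding_apply] at hS
    obtain ⟨⟨T, T'⟩, ⟨hT, hT'⟩, rfl⟩ := hS
    rw [linearIndepOn_finset_iff]
    intro f hf
    rw [Finset.sum_disjSum, Prod.ext_iff] at hf
    simp only [Sum.elim_inl, Sum.elim_inr, Function.comp_apply, ← map_smul, ← map_sum] at hf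
    simp only [LinearMap.inl_apply, LinearMap.inr_apply, Prod.mk_add_mk, add_zero, zero_add,
      Prod.fst_zero, Prod.snd_zero] at hf
    have h1 := linearIndepOn_finset_iff.1 (h.linearIndepOn T hT) _ hf.1
    have h2 := linearIndepOn_finset_iff.1 (h'.linearIndepOn T' hT') _ hf.2
    rintro (x | x) hx
    · exact h1 x (Finset.inl_mem_disjSum.1 hx)
    · exact h2 x (Finset.inr_mem_disjSum.1 hx)
  eq_zero g hg := by
    refine LinearMap.prod_ext ?_ ?_
    · rw [LinearMap.zero_comp]
      exact h.eq_zero _ fun x hx => hg (Sum.inl x) (Finset.inl_mem_disjSum.2 hx)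
    · rw [LinearMap.zero_comp]
      exact h'.eq_zero _ fun x hx => hg (Sum.inr x) (Finset.inr_mem_disjSum.2 hx)
  filter_mem g c hc hg := by
    simp only [Finset.mem_map, Finset.mem_product, disjSumEmbedding_apply]
    refine ⟨(_, _), ⟨h.filter_mem (g ∘ₗ LinearMap.inl ℝ E E') c hc
        fun x hx => hg (Sum.inl x) (Finset.inl_mem_disjSum.2 hx),
      h'.filter_mem (g ∘ₗ LinearMap.inr ℝ E E') c hc
        fun x hx => hg (Sum.inr x) (Finset.inr_mem_disjSum.2 hx)⟩, ?_⟩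
    ext (x | x)
    · refine Finset.inl_mem_disjSum.trans (Finset.mem_filter.trans ?_)
      rw [Finset.mem_filter, Finset.inl_mem_disjSum]
      rfl
    · refine Finset.inr_mem_disjSum.trans (Finset.mem_filter.trans ?_)
      rw [Finset.mem_filter, Finset.inr_mem_disjSum]
      rfl
  exists_support S hS hcard := by
    simp only [Finset.mem_map, Finset.mem_product, disjSumEmbedding_apply] at hS
    obtain ⟨⟨T, T'⟩, ⟨hT, hT'⟩, rfl⟩ := hS
    have hle : T.card ≤ Module.finrank ℝ E := by
      simpa using LinearIndependent.fintype_card_le_finrank (h.linearIndepOn T hT)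
    have hle' : T'.card ≤ Module.finrank ℝ E' := by
      simpa using LinearIndependent.fintype_card_le_finrank (h'.linearIndepOn T' hT')
    simp only [Finset.card_disjSum, Module.finrank_prod] at hcard
    obtain ⟨g, hg⟩ := h.exists_support T hT (by omega)
    obtain ⟨g', hg'⟩ := h'.exists_support T' hT' (by omega)
    refine ⟨g.coprod g', ?_⟩
    rintro (x | x) hx
    · simpa using hg x (Finset.inl_mem_disjSum.1 hx)
    · simpa using hg' x (Finset.inr_mem_disjSum.1 hx)

end Operations

end IsSimplicialConfig

open Polynomial in
/-- There is a simplicial vector configuration in `ℝ^d` whose family has the given size enumerator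
polynomial. -/
def HasConfig (d : ℕ) (p : ℝ[X]) : Prop :=
  ∃ (J : Type) (v : J → Euc d) (A : Finset J) (𝓕 : Finset (Finset J)),
    IsSimplicialConfig v A 𝓕 ∧ p = ∑ S ∈ 𝓕, (X : ℝ[X]) ^ S.card

namespace HasConfig

open Polynomial

theorem of_finrank {E : Type*} [AddCommGroup E] [Module ℝ E] [FiniteDimensional ℝ E] {J : Type}
    {v : J → E} {A : Finset J} {𝓕 : Finset (Finset J)} (h : IsSimplicialConfig v A 𝓕) {d : ℕ}
    (hd : Module.finrank ℝ E = d) : HasConfig d (∑ S ∈ 𝓕, (X : ℝ[X]) ^ S.card) :=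
  ⟨J, _, A, 𝓕, h.map (LinearEquiv.ofFinrankEq E (Euc d) (by simpa using hd)), rfl⟩

theorem mul {d d' : ℕ} {p p' : ℝ[X]} (h : HasConfig d p) (h' : HasConfig d' p') :
    HasConfig (d + d') (p * p') := by
  obtain ⟨J, v, A, 𝓕, h, rfl⟩ := h
  obtain ⟨J', v', A', 𝓕', h', rfl⟩ := h'
  have := of_finrank (h.prod h') (d := d + d') (by simp)
  simpa [Finset.sum_mul_sum, Finset.sum_product, pow_add] using this

theorem zero_one : HasConfig 0 1 := by
  have h : IsSimplicialConfig (fun x : Empty => (x.elim : Euc 0)) ∅ {∅} :=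
    { subset := by simp
      linearIndepOn := by simp
      eq_zero := fun g _ => by
        ext y
        rw [Subsingleton.elim y 0, map_zero, map_zero]
      filter_mem := by simp
      exists_support := by simp }
  simpa using of_finrank h (by simp)

theorem pow {d : ℕ} {p : ℝ[X]} (h : HasConfig d p) (m : ℕ) : HasConfig (d * m) (p ^ m) := by
  induction m with
  | zero => simpa using zero_one
  | succ m ih => simpa [pow_succ, Nat.mul_succ] using ih.mul h

/-- The configuration of the two endpoints of a segment. -/
theorem segment : HasConfig 1 (1 + 2 * X) := by
  have h : IsSimplicialConfig (fun x : ℤ => (x : ℝ)) {-1, 1} {∅, {-1}, {1}} :=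
    { subset := by simp
      linearIndepOn := by
        intro S hS
        simp only [Finset.mem_insert, Finset.mem_singleton] at hS
        rcases hS with rfl | rfl | rfl <;> simp
      eq_zero := fun g hg => by
        have h1 := hg 1 (by simp)
        have h2 := hg (-1) (by simp)
        simp only [Int.cast_neg, Int.cast_one, map_neg] at h1 h2
        ext
        simp only [LinearMap.zero_apply]
        linarith
      filter_mem := fun g c hc hg => by
        have hm : g (-1) = -g 1 := map_neg g 1
        simp only [Finset.filter_insert, Finset.filter_singleton, Int.cast_neg, Int.cast_one, hm]
        split_ifs with h1 h2
        · linarith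
        · simp
        · simp
        · simp
      exists_support := fun S hS hcard => by
        simp only [Finset.mem_insert, Finset.mem_singleton] at hS
        rcases hS with rfl | rfl | rfl
        · simp at hcard
        · refine ⟨-LinearMap.id, ?_⟩
          norm_num
        · refine ⟨LinearMap.id, ?_⟩
          norm_num }
  have := of_finrank h (d := 1) (by simp)
  convert this using 1
  rw [Finset.sum_insert (by simp), Finset.sum_insert (by simp), Finset.sum_singleton]
  simp only [Finset.card_empty, Finset.card_singleton]
  ring

/-- The successor of a vertex on the polygon with vertices `-M, …, M`. -/
def cyclicSucc (M x : ℤ) : ℤ := if x = M then -M else x + 1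

theorem cyclicSucc_injOn {M : ℤ} (hM : 2 ≤ M) :
    Set.InjOn (fun x => ({x, cyclicSucc M x} : Finset ℤ)) (Finset.Icc (-M) M) := by
  intro x hx y hy hxy
  simp only [Finset.coe_Icc, Set.mem_Icc] at hx hy
  have h1 : x ∈ ({y, cyclicSucc M y} : Finset ℤ) := by
    rw [← show _ = ({y, cyclicSucc M y} : Finset ℤ) from hxy]
    simp
  have h2 : y ∈ ({x, cyclicSucc M x} : Finset ℤ) := by
    rw [show ({x, cyclicSucc M x} : Finset ℤ) = _ from hxy]
    simp
  simp only [Finset.mem_insert, Finset.mem_singleton, cyclicSucc] at h1 h2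
  split_ifs at h1 h2 <;> omega

theorem cyclicSucc_ne {M x : ℤ} (hM : 2 ≤ M) : x ≠ cyclicSucc M x := by
  unfold cyclicSucc
  split_ifs <;> omega

theorem cyclicSucc_mem {M x : ℤ} (hM : 2 ≤ M) (hx : x ∈ Finset.Icc (-M) M) :
    cyclicSucc M x ∈ Finset.Icc (-M) M := by
  rw [Finset.mem_Icc] at hx ⊢
  unfold cyclicSucc
  split_ifs <;> omega

/-- The proper faces of the polygon with vertices `-M, …, M`. -/
def polygonFaces (M : ℤ) : Finset (Finset ℤ) :=
  insert ∅ ((Finset.Icc (-M) M).image singleton ∪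
    (Finset.Icc (-M) M).image fun x => {x, cyclicSucc M x})

theorem mem_polygonFaces {M : ℤ} {S : Finset ℤ} : S ∈ polygonFaces M ↔
    S = ∅ ∨ (∃ x ∈ Finset.Icc (-M) M, S = {x}) ∨
      ∃ x ∈ Finset.Icc (-M) M, S = {x, cyclicSucc M x} := by
  simp [polygonFaces, eq_comm]

theorem sum_polygonFaces {M : ℕ} (hM : 2 ≤ M) :
    ∑ S ∈ polygonFaces M, (X : ℝ[X]) ^ S.card =
      1 + C (2 * M + 1 : ℝ) * X + C (2 * M + 1 : ℝ) * X ^ 2 := by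
  have hM' : (2 : ℤ) ≤ M := by exact_mod_cast hM
  have hcard : (Finset.Icc (-(M : ℤ)) M).card = 2 * M + 1 := by
    rw [Int.card_Icc]
    omega
  rw [polygonFaces, Finset.sum_insert, Finset.sum_union, Finset.sum_image, Finset.sum_image]
  · simp only [Finset.card_empty, pow_zero, Finset.card_singleton, pow_one,
      Finset.card_pair (cyclicSucc_ne hM'), Finset.sum_const, hcard, nsmul_eq_mul]
    simp only [Nat.cast_add, Nat.cast_mul, Nat.cast_ofNat, Nat.cast_one, map_add, map_mul,
      map_ofNat, map_natCast, map_one]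
    ring
  · exact cyclicSucc_injOn hM'
  · exact Finset.singleton_injective.injOn
  · rw [Finset.disjoint_left]
    intro S hS hS'
    obtain ⟨x, -, rfl⟩ := Finset.mem_image.1 hS
    obtain ⟨y, -, hy⟩ := Finset.mem_image.1 hS'
    have := congrArg Finset.card hy
    rw [Finset.card_pair (cyclicSucc_ne hM'), Finset.card_singleton] at this
    omega
  · simp only [Finset.mem_union, Finset.mem_image, not_or, not_exists, not_and]
    exact ⟨fun x _ => Finset.singleton_ne_empty x, fun x _ => Finset.insert_ne_empty _ _⟩

/-- Points on a parabola. -/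
def parabola (x : ℤ) : ℝ × ℝ := (x, x ^ 2 - 1)

theorem apply_parabola (g : ℝ × ℝ →ₗ[ℝ] ℝ) (x : ℤ) :
    g (parabola x) = g (1, 0) * x + g (0, 1) * ((x : ℝ) ^ 2 - 1) := by
  have : parabola x = (x : ℝ) • ((1, 0) : ℝ × ℝ) + ((x : ℝ) ^ 2 - 1) • ((0, 1) : ℝ × ℝ) := by
    simp [parabola]
  rw [this, map_add, map_smul, map_smul, smul_eq_mul, smul_eq_mul]
  ring

theorem exists_functional (a b : ℝ) : ∃ g : ℝ × ℝ →ₗ[ℝ] ℝ,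
    ∀ x : ℤ, g (parabola x) = a * x + b * ((x : ℝ) ^ 2 - 1) :=
  ⟨(a • LinearMap.id).coprod (b • LinearMap.id), fun x => by simp [parabola]⟩

theorem linearIndepOn_parabola_pair {x y : ℤ} (hxy : x ≠ y) (h : x * y + 1 ≠ 0) :
    LinearIndepOn ℝ parabola ({x, y} : Set ℤ) := by
  rw [LinearIndepOn.pair_iff _ hxy]
  intro a b hab
  have hxy' : (x : ℝ) - y ≠ 0 := sub_ne_zero.2 (by exact_mod_cast hxy)
  have h' : (x : ℝ) * y + 1 ≠ 0 := by exact_mod_cast h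
  simp only [parabola, Prod.smul_mk, Prod.mk_add_mk, Prod.mk_eq_zero, smul_eq_mul] at hab
  obtain ⟨h1, h2⟩ := hab
  have hne := mul_ne_zero hxy' h'
  constructor
  · refine (mul_eq_zero.1 (?_ : a * (((x : ℝ) - y) * (x * y + 1)) = 0)).resolve_right hne
    linear_combination (1 - (y : ℝ) ^ 2) * h1 + y * h2
  · refine (mul_eq_zero.1 (?_ : b * (((x : ℝ) - y) * (x * y + 1)) = 0)).resolve_right hne
    linear_combination ((x : ℝ) ^ 2 - 1) * h1 - x * h2

/-- If a polynomial function `c - a t - b (t ^ 2 - 1)` is nonnegative on the integers in `[-M, M]`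
and vanishes at two of them, then these are consecutive in the cyclic order. -/
theorem eq_cyclicSucc_of_roots {M x y : ℤ} {a b c : ℝ} (hc : 0 < c)
    (hx : x ∈ Finset.Icc (-M) M) (hy : y ∈ Finset.Icc (-M) M) (hxy : x < y)
    (hle : ∀ t ∈ Finset.Icc (-M) M, a * t + b * ((t : ℝ) ^ 2 - 1) ≤ c)
    (hxc : a * x + b * ((x : ℝ) ^ 2 - 1) = c) (hyc : a * y + b * ((y : ℝ) ^ 2 - 1) = c) :
    y = x + 1 ∨ x = -M ∧ y = M := by
  have hxy' : (x : ℝ) < y := by exact_mod_cast hxy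
  have ha : a = -b * (x + y) := by
    refine mul_right_cancel₀ (sub_ne_zero.2 hxy'.ne) ?_
    linear_combination hxc - hyc
  have key : ∀ t ∈ Finset.Icc (-M) M, b * (((t : ℝ) - x) * (t - y)) ≤ 0 := by
    intro t ht
    have := hle t ht
    rw [← hxc, ha] at this
    linarith
  have hb : b ≠ 0 := by
    rintro rfl
    simp only [neg_zero, zero_mul] at ha
    simp only [ha, zero_mul, add_zero] at hxc
    exact hc.ne hxc
  rw [Finset.mem_Icc] at hx hy
  by_contra! hcon
  obtain ⟨h1, h2⟩ := hcon
  have hin := key (x + 1) (Finset.mem_Icc.2 (by omega))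
  have hylt : (x : ℝ) + 1 < y := by exact_mod_cast (by omega : x + 1 < y)
  push_cast at hin
  have hbpos : 0 < b := by
    rcases hb.lt_or_gt with hb | hb
    · exfalso
      nlinarith
    · exact hb
  by_cases hxM : x = -M
  · have hyM : y < M := by have := h2 hxM; omega
    have := key (y + 1) (Finset.mem_Icc.2 (by omega))
    push_cast at this
    nlinarith
  · have := key (x - 1) (Finset.mem_Icc.2 (by omega))
    push_cast at this
    nlinarith

theorem filter_mem_polygonFaces {M : ℤ} (hM : 2 ≤ M) {a b c : ℝ} (hc : 0 < c)
    (hle : ∀ t ∈ Finset.Icc (-M) M, a * t + b * ((t : ℝ) ^ 2 - 1) ≤ c) :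
    ({t ∈ Finset.Icc (-M) M | a * t + b * ((t : ℝ) ^ 2 - 1) = c} : Finset ℤ) ∈ polygonFaces M := by
  set S : Finset ℤ := {t ∈ Finset.Icc (-M) M | a * t + b * ((t : ℝ) ^ 2 - 1) = c} with hS
  have hpair : ∀ x ∈ S, ∀ y ∈ S, x < y → y = x + 1 ∨ x = -M ∧ y = M := by
    intro x hx y hy hxy
    rw [hS, Finset.mem_filter] at hx hy
    exact eq_cyclicSucc_of_roots hc hx.1 hy.1 hxy hle hx.2 hy.2
  have hSI : ∀ x ∈ S, -M ≤ x ∧ x ≤ M := fun x hx => by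
    rw [hS, Finset.mem_filter, Finset.mem_Icc] at hx
    exact hx.1
  clear_value S
  rw [mem_polygonFaces]
  rcases S.eq_empty_or_nonempty with h0 | hne
  · exact Or.inl h0
  right
  set x := S.min' hne with hxdef
  set y := S.max' hne with hydef
  have hx : x ∈ S := S.min'_mem hne
  have hy : y ∈ S := S.max'_mem hne
  have hbd : ∀ z ∈ S, x ≤ z ∧ z ≤ y := fun z hz => ⟨S.min'_le z hz, S.le_max' z hz⟩
  have hSx := hSI x hx
  have hSy := hSI y hy
  rcases (hbd y hy).1.eq_or_lt with hxy | hxy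
  · refine Or.inl ⟨x, Finset.mem_Icc.2 hSx, ?_⟩
    ext z
    rw [Finset.mem_singleton]
    exact ⟨fun hz => by have := hbd z hz; omega, fun hz => hz ▸ hx⟩
  · right
    have hSxy : S = {x, y} := by
      ext z
      rw [Finset.mem_insert, Finset.mem_singleton]
      constructor
      · intro hz
        by_contra! hcon
        have hz' := hbd z hz
        have h1 := hpair x hx z hz (by omega)
        have h2 := hpair z hz y hy (by omega)
        have h3 := hpair x hx y hy hxy
        clear_value x y
        omega
      · rintro (rfl | rfl) <;> assumption
    rcases hpair x hx y hy hxy with h | ⟨h1, h2⟩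
    · refine ⟨x, Finset.mem_Icc.2 hSx, ?_⟩
      rw [cyclicSucc, if_neg (show ¬x = M by omega), hSxy, h]
    · refine ⟨y, Finset.mem_Icc.2 hSy, ?_⟩
      rw [cyclicSucc, if_pos h2, hSxy, ← h1, Finset.pair_comm]

theorem isSimplicialConfig_polygon {M : ℤ} (hM : 2 ≤ M) :
    IsSimplicialConfig parabola (Finset.Icc (-M) M) (polygonFaces M) where
  subset S hS := by
    rcases mem_polygonFaces.1 hS with rfl | ⟨x, hx, rfl⟩ | ⟨x, hx, rfl⟩
    · simp
    · simpa using hx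
    · rw [Finset.insert_subset_iff, Finset.singleton_subset_iff]
      exact ⟨hx, cyclicSucc_mem hM hx⟩
  linearIndepOn S hS := by
    rcases mem_polygonFaces.1 hS with rfl | ⟨x, hx, rfl⟩ | ⟨x, hx, rfl⟩
    · simp
    · rw [Finset.coe_singleton, linearIndepOn_singleton_iff]
      intro h0
      simp only [parabola, Prod.mk_eq_zero] at h0
      rw [h0.1] at h0
      norm_num at h0
    · rw [Finset.coe_pair]
      refine linearIndepOn_parabola_pair (cyclicSucc_ne hM) ?_
      unfold cyclicSucc
      split_ifs with h
      · subst h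
        nlinarith
      · have : 0 ≤ x * (x + 1) := by
          rcases le_or_gt 0 x with h0 | h0 <;> nlinarith
        omega
  eq_zero g hg := by
    have h0 := hg 0 (Finset.mem_Icc.2 (by omega))
    have h1 := hg 1 (Finset.mem_Icc.2 (by omega))
    have h2 := hg (-1) (Finset.mem_Icc.2 (by omega))
    have h3 := hg 2 (Finset.mem_Icc.2 (by omega))
    have h4 := hg (-2) (Finset.mem_Icc.2 (by omega))
    rw [apply_parabola] at h0 h1 h2 h3 h4
    push_cast at h0 h1 h2 h3 h4
    have ha : g (1, 0) = 0 := by linarith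
    have hb : g (0, 1) = 0 := by linarith
    refine LinearMap.prod_ext ?_ ?_ <;> ext <;> simpa
  filter_mem g c hc hg := by
    simp only [apply_parabola] at hg ⊢
    exact filter_mem_polygonFaces hM hc hg
  exists_support S hS hcard := by
    rcases mem_polygonFaces.1 hS with rfl | ⟨x, hx, rfl⟩ | ⟨x, hx, rfl⟩
    · simp at hcard
    · simp at hcard
    · by_cases hxM : x = M
      · subst hxM
        have hx1 : (0 : ℝ) < (x : ℝ) ^ 2 - 1 := by
          have : (2 : ℝ) ≤ x := by exact_mod_cast hM
          nlinarith
        obtain ⟨g, hg⟩ := exists_functional 0 ((x : ℝ) ^ 2 - 1)⁻¹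
        refine ⟨g, fun t ht => ?_⟩
        rw [Finset.mem_Icc] at ht
        rw [hg, zero_mul, zero_add, inv_mul_le_iff₀ hx1, inv_mul_eq_iff_eq_mul₀ hx1.ne', mul_one]
        constructor
        · have : (t : ℝ) ^ 2 ≤ (x : ℝ) ^ 2 := by
            exact_mod_cast (sq_le_sq' ht.1 ht.2)
          linarith
        · rw [sub_left_inj, sq_eq_sq_iff_eq_or_eq_neg]
          simp only [cyclicSucc, if_true, Finset.mem_insert, Finset.mem_singleton]
          norm_cast
      · have hpos : 0 ≤ x * (x + 1) := by
          rcases le_or_gt 0 x with h0 | h0 <;> nlinarith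
        have hpos' : (0 : ℝ) < x * (x + 1) + 1 := by exact_mod_cast Int.lt_add_one_of_le hpos
        obtain ⟨g, hg⟩ := exists_functional ((2 * x + 1) / (x * (x + 1) + 1))
          (-1 / (x * (x + 1) + 1))
        refine ⟨g, fun t ht => ?_⟩
        have hgt : g (parabola t) = 1 - ((t - x) * (t - (x + 1)) : ℤ) / (x * (x + 1) + 1 : ℝ) := by
          rw [hg]
          field_simp
          push_cast
          ring
        have hnn : 0 ≤ (t - x) * (t - (x + 1)) := by
          rcases le_or_gt t x with h0 | h0
          · nlinarith
          · exact mul_nonneg (by omega) (by omega)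
        rw [hgt]
        constructor
        · have : (0 : ℝ) ≤ ((t - x) * (t - (x + 1)) : ℤ) / (x * (x + 1) + 1 : ℝ) :=
            div_nonneg (by exact_mod_cast hnn) hpos'.le
          linarith
        · rw [sub_eq_self, div_eq_zero_iff, or_iff_left hpos'.ne', Int.cast_eq_zero, mul_eq_zero,
            sub_eq_zero, sub_eq_zero]
          simp [cyclicSucc, hxM]

theorem polygon {M : ℕ} (hM : 2 ≤ M) :
    HasConfig 2 (1 + C (2 * M + 1 : ℝ) * X + C (2 * M + 1 : ℝ) * X ^ 2) := by
  rw [← sum_polygonFaces hM]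
  exact of_finrank (isSimplicialConfig_polygon (by exact_mod_cast hM)) (by simp)

theorem exists_polytope {d k : ℕ} {p : ℝ[X]} (h : HasConfig d p) (hk : k + 1 ≤ d) :
    ∃ Q : Set (Euc d), IsPolytope Q ∧ dimSet Q = d ∧ (fVec Q k : ℝ) ≤ p.coeff (k + 1) ∧
      p.coeff d = fVec Q (d - 1) := by
  classical
  obtain ⟨J, v, A, 𝓕, h, rfl⟩ := h
  have hcoeff : ∀ j, (∑ S ∈ 𝓕, (X : ℝ[X]) ^ S.card).coeff j =
      ({S ∈ 𝓕 | S.card = j} : Finset (Finset J)).card := by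
    intro j
    simp only [finsetSum_coeff, coeff_X_pow, Finset.sum_boole, eq_comm]
  have hd : Module.finrank ℝ (Euc d) = d := by simp
  refine ⟨convexHull ℝ (v '' (A : Set J)), ⟨A.image v, by simp⟩, ?_, ?_, ?_⟩
  · rw [h.dimSet_convexHull, hd]
  · rw [hcoeff]
    exact_mod_cast h.fVec_le (by omega)
  · have h1 := h.fVec_le (k := d - 1) (by omega)
    have h2 := h.le_fVec (k := d - 1) (by omega)
    rw [hcoeff]
    rw [Nat.sub_add_cancel (by omega)] at h1 h2
    exact_mod_cast h2.antisymm h1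

end HasConfig

section Asymptotics

open Polynomial

/-- A family of polynomials all of whose coefficients are continuous in the parameter. -/
theorem continuous_coeff_mul {p q : ℝ → ℝ[X]} (hp : ∀ j, Continuous fun s => (p s).coeff j)
    (hq : ∀ j, Continuous fun s => (q s).coeff j) (j : ℕ) :
    Continuous fun s => (p s * q s).coeff j := by
  simp only [coeff_mul]
  exact continuous_finsetSum _ fun i _ => (hp i.1).mul (hq i.2)

theorem continuous_coeff_pow {p : ℝ → ℝ[X]} (hp : ∀ j, Continuous fun s => (p s).coeff j)
    (m j : ℕ) : Continuous fun s => (p s ^ m).coeff j := by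
  induction m generalizing j with
  | zero => simpa using continuous_const
  | succ m ih =>
    simp only [pow_succ]
    exact continuous_coeff_mul ih hp j

theorem coeff_add_sq_pow (m i t : ℕ) (h : i + t = 2 * m) :
    ((X + X ^ 2 : ℝ[X]) ^ m).coeff i = m.choose t := by
  rw [show (X + X ^ 2 : ℝ[X]) = (1 + X) * X by ring, mul_pow, coeff_mul_X_pow']
  split_ifs with hi
  · rw [coeff_one_add_X_pow, Nat.choose_symm_of_eq_add (by omega : m = i - m + t)]
  · rw [Nat.choose_eq_zero_of_lt (by omega), Nat.cast_zero]

theorem coeff_add_sq_pow_mul (m e j s : ℕ) (he : e ≤ 1) (hj : j + s = 2 * m + e) :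
    ((X + X ^ 2 : ℝ[X]) ^ m * (1 + 2 * X) ^ e).coeff j = 2 ^ e * (rho (2 * m + e) s : ℝ) := by
  interval_cases e
  · rw [pow_zero, mul_one, coeff_add_sq_pow m j s (by omega), rho,
      show (2 * m + 0 + 1) / 2 = m by omega, show (2 * m + 0) / 2 = m by omega]
    push_cast
    ring
  · have hsplit : (X + X ^ 2 : ℝ[X]) ^ m * (1 + 2 * X) ^ 1 =
        (X + X ^ 2) ^ m + C 2 * ((X + X ^ 2) ^ m * X) := by
      rw [show (C 2 : ℝ[X]) = 2 from map_ofNat C 2]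
      ring
    rw [hsplit, coeff_add, coeff_C_mul, rho, show (2 * m + 1 + 1) / 2 = m + 1 by omega,
      show (2 * m + 1) / 2 = m by omega]
    rcases s with _ | t
    · obtain rfl : j = 2 * m + 1 := by omega
      have hzero : ((X + X ^ 2 : ℝ[X]) ^ m).coeff (2 * m + 1) = 0 := by
        rw [show (X + X ^ 2 : ℝ[X]) = (1 + X) * X by ring, mul_pow, coeff_mul_X_pow',
          if_pos (by omega), coeff_one_add_X_pow, Nat.choose_eq_zero_of_lt (by omega),
          Nat.cast_zero]
      rw [coeff_mul_X, coeff_add_sq_pow m (2 * m) 0 rfl, hzero]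
      simp
    · rw [coeff_add_sq_pow m j t (by omega), Nat.choose_succ_succ']
      rcases j with _ | j
      · rw [coeff_mul_X_zero, Nat.choose_eq_zero_of_lt (by omega : m < t + 1)]
        push_cast
        ring
      · rw [coeff_mul_X, coeff_add_sq_pow m j (t + 1) (by omega)]
        push_cast
        ring

theorem exists_coeff_lt (m e k : ℕ) (he : e ≤ 1) (hk : k + 1 ≤ 2 * m + e) {ε : ℝ} (hε : 0 < ε) :
    ∃ M : ℕ, 2 ≤ M ∧
      ((1 + C (2 * M + 1 : ℝ) * X + C (2 * M + 1 : ℝ) * X ^ 2) ^ m *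
        (1 + 2 * X) ^ e).coeff (k + 1) <
      ((rho (2 * m + e) (2 * m + e - k - 1) : ℝ) + ε) *
        ((1 + C (2 * M + 1 : ℝ) * X + C (2 * M + 1 : ℝ) * X ^ 2) ^ m *
          (1 + 2 * X) ^ e).coeff (2 * m + e) := by
  set r : ℝ := (rho (2 * m + e) (2 * m + e - k - 1) : ℝ) + ε with hr
  set R : ℝ → ℝ[X] := fun s => (C s + (X + X ^ 2)) ^ m * (1 + 2 * X) ^ e with hR
  have hcont : ∀ j, Continuous fun s => (R s).coeff j := by
    refine continuous_coeff_mul (continuous_coeff_pow (fun j => ?_) m) fun j => continuous_const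
    simp only [coeff_add, coeff_C]
    split_ifs <;> fun_prop
  have hlim : Filter.Tendsto (fun s => (R s).coeff (k + 1) - r * (R s).coeff (2 * m + e))
      (nhds 0) (nhds ((R 0).coeff (k + 1) - r * (R 0).coeff (2 * m + e))) :=
    ((hcont _).sub (continuous_const.mul (hcont _))).tendsto 0
  have hneg : (R 0).coeff (k + 1) - r * (R 0).coeff (2 * m + e) < 0 := by
    have hrho : rho (2 * m + e) 0 = 1 := by norm_num [rho]
    simp only [hR, map_zero, zero_add]
    rw [coeff_add_sq_pow_mul m e (k + 1) (2 * m + e - k - 1) he (by omega),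
      coeff_add_sq_pow_mul m e (2 * m + e) 0 he rfl, hrho, hr]
    have : (0 : ℝ) < 2 ^ e * ε := by positivity
    push_cast
    linarith
  have hs : Filter.Tendsto (fun M : ℕ => ((2 * M + 1 : ℝ))⁻¹) Filter.atTop (nhds 0) :=
    tendsto_inv_atTop_zero.comp (Filter.tendsto_atTop_add_const_right _ _
      (tendsto_natCast_atTop_atTop.const_mul_atTop two_pos))
  obtain ⟨M, hM, hM2⟩ := (((hlim.comp hs).eventually_lt_const hneg).and
    (Filter.eventually_ge_atTop 2)).exists
  refine ⟨M, hM2, ?_⟩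
  have hn : (0 : ℝ) < 2 * M + 1 := by positivity
  have hfac : (1 + C (2 * M + 1 : ℝ) * X + C (2 * M + 1 : ℝ) * X ^ 2) ^ m * (1 + 2 * X) ^ e =
      C ((2 * M + 1 : ℝ) ^ m) * R (2 * M + 1 : ℝ)⁻¹ := by
    simp only [hR]
    rw [C_pow, ← mul_assoc, ← mul_pow]
    congr 2
    rw [mul_add, ← C_mul, mul_inv_cancel₀ hn.ne', C_1]
    ring
  rw [hfac, coeff_C_mul, coeff_C_mul, mul_left_comm]
  refine mul_lt_mul_of_pos_left ?_ (pow_pos hn m)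
  exact sub_neg.1 hM

end Asymptotics

/-- For `d ≥ 1`, `0 ≤ k ≤ d-1`, and real `ε > 0`, there is a
`d`-polytope `Q` with `f_k(Q) < (ρ(d,d-k-1) + ε) ⬝ f_{d-1}(Q)`. -/
theorem exists_polytope_facet_ratio_close (d k : ℕ) (hd : 1 ≤ d) (hk : k + 1 ≤ d)
    (ε : ℝ) (hε : 0 < ε) :
    ∃ (N : ℕ) (Q : Set (Euc N)), IsPolytope Q ∧ dimSet Q = d ∧
      (fVec Q k : ℝ) < ((rho d (d - k - 1) : ℚ) + ε) * (fVec Q (d - 1) : ℝ) := by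
  obtain ⟨m, e, he, rfl⟩ : ∃ m e, e ≤ 1 ∧ d = 2 * m + e :=
    ⟨d / 2, d % 2, by omega, by omega⟩
  obtain ⟨M, hM, hlt⟩ := exists_coeff_lt m e k he hk hε
  have hconfig := ((HasConfig.polygon hM).pow m).mul (HasConfig.segment.pow e)
  rw [one_mul] at hconfig
  obtain ⟨Q, hQ, hdim, hle, heq⟩ := hconfig.exists_polytope hk
  refine ⟨_, Q, hQ, hdim, ?_⟩
  rw [← heq]
  exact hle.trans_lt hlt
end
end
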